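/- The category ⟨∅⟩ generated by no additional partitions consists exactly of the noncrossing two-colored pair partitions p (all blocks of size two) such that, when p is rotated to a partition with no upper points, every block connects a white point and a black point. -/

import Mathlib

noncomputable section
namespace CTCP

/-- Colors of points: `true` = white (∘), `false` = black (•). -/
abbrev Color := Bool

def white : Color := true
def black : Color := false

/-- A two-colored partition with `k` upper and `l` lower points.  The block
structure is recorded as a setoid on the disjoint union of the points. -/
structure TCP where
  k : ℕ
  l : ℕ
  upColor : Fin k → Color
  lowColor : Fin l → Color
  rel : Setoid (Fin k ⊕ Fin l)

/-- The disjoint union of two equivalence relations. -/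
def sumRel {α β : Type*} (r : Setoid α) (s : Setoid β) : (α ⊕ β) → (α ⊕ β) → Prop
  | .inl a, .inl b => r.r a b
  | .inr a, .inr b => s.r a b
  | _, _ => False

def sumSetoid {α β : Type*} (r : Setoid α) (s : Setoid β) : Setoid (α ⊕ β) where
  r := sumRel r s
  iseqv := by
    constructor
    · rintro (a | a)
      · exact r.iseqv.refl a
      · exact s.iseqv.refl a
    · rintro (a | a) (b | b) h
      · exact r.iseqv.symm h
      · exact h.elim
      · exact h.elim
      · exact s.iseqv.symm h
    · rintro (a | a) (b | b) (c | c) h₁ h₂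
      all_goals first
        | exact r.iseqv.trans h₁ h₂
        | exact s.iseqv.trans h₁ h₂
        | exact h₁.elim
        | exact h₂.elim

def splitPt (p q : TCP) :
    (Fin (p.k + q.k) ⊕ Fin (p.l + q.l)) → ((Fin p.k ⊕ Fin p.l) ⊕ (Fin q.k ⊕ Fin q.l))
  | .inl i => (finSumFinEquiv.symm i).elim (fun a => .inl (.inl a)) (fun b => .inr (.inl b))
  | .inr j => (finSumFinEquiv.symm j).elim (fun a => .inl (.inr a)) (fun b => .inr (.inr b))

/-- Tensor product (horizontal concatenation) of two-colored partitions. -/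
def tensor (p q : TCP) : TCP where
  k := p.k + q.k
  l := p.l + q.l
  upColor := fun i => (finSumFinEquiv.symm i).elim p.upColor q.upColor
  lowColor := fun j => (finSumFinEquiv.symm j).elim p.lowColor q.lowColor
  rel := Setoid.comap (splitPt p q) (sumSetoid p.rel q.rel)

def compEmbMid (q p : TCP) (h : q.l = p.k) :
    (Fin p.k ⊕ Fin p.l) → ((Fin q.k ⊕ Fin q.l) ⊕ Fin p.l)
  | .inl i => .inl (.inr (Fin.cast h.symm i))
  | .inr j => .inr j

/-- The relation generating the blocks of the composition of `q` and `p`: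
the blocks of `q` together with the blocks of `p`, glued along the middle row. -/
def compRel (q p : TCP) (h : q.l = p.k) :
    ((Fin q.k ⊕ Fin q.l) ⊕ Fin p.l) → ((Fin q.k ⊕ Fin q.l) ⊕ Fin p.l) → Prop :=
  fun t t' =>
    (∃ x y, q.rel.r x y ∧ t = .inl x ∧ t' = .inl y) ∨
    (∃ x y, p.rel.r x y ∧ t = compEmbMid q p h x ∧ t' = compEmbMid q p h y)

/-- Composition (vertical concatenation) of `q ∈ P(k,l)` with `p ∈ P(l,m)`:
blocks are joined through the middle points, which are then deleted. -/
def comp (q p : TCP) (h : q.l = p.k) : TCP where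
  k := q.k
  l := p.l
  upColor := q.upColor
  lowColor := p.lowColor
  rel := Setoid.comap
    (Sum.elim (fun i : Fin q.k => (Sum.inl (Sum.inl i) : (Fin q.k ⊕ Fin q.l) ⊕ Fin p.l))
      (fun j : Fin p.l => Sum.inr j))
    (Relation.EqvGen.setoid (compRel q p h))

/-- The colors of the lower row of `q` match the colors of the upper row of `p`. -/
def ColorsMatch (q p : TCP) (h : q.l = p.k) : Prop :=
  ∀ j : Fin q.l, q.lowColor j = p.upColor (Fin.cast h j)

/-- Involution: reflection at the horizontal axis. -/
def invol (p : TCP) : TCP where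
  k := p.l
  l := p.k
  upColor := p.lowColor
  lowColor := p.upColor
  rel := Setoid.comap Sum.swap p.rel

/-- Vertical reflection: reflection at the vertical axis. -/
def vref (p : TCP) : TCP where
  k := p.k
  l := p.l
  upColor := fun i => p.upColor i.rev
  lowColor := fun j => p.lowColor j.rev
  rel := Setoid.comap (Sum.map Fin.rev Fin.rev) p.rel

/-- Inversion of colors. -/
def cinv (p : TCP) : TCP where
  k := p.k
  l := p.l
  upColor := fun i => !(p.upColor i)
  lowColor := fun j => !(p.lowColor j)
  rel := p.rel

/-- Verticolor reflection `p̃`: vertical reflection combined with color inversion. -/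
def vcref (p : TCP) : TCP := cinv (vref p)

/-- Rotation of the leftmost upper point to the left end of the lower row
(inverting its color). -/
def rotULdown (p : TCP) (h : 0 < p.k) : TCP where
  k := p.k - 1
  l := p.l + 1
  upColor := fun i => p.upColor ⟨i.1 + 1, by have := i.2; omega⟩
  lowColor := fun j =>
    if hj : j.1 = 0 then !(p.upColor ⟨0, h⟩)
    else p.lowColor ⟨j.1 - 1, by have := j.2; omega⟩
  rel := Setoid.comap
    (Sum.elim
      (fun i : Fin (p.k - 1) => (Sum.inl ⟨i.1 + 1, by have := i.2; omega⟩ : Fin p.k ⊕ Fin p.l))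
      (fun j : Fin (p.l + 1) =>
        if hj : j.1 = 0 then Sum.inl ⟨0, h⟩
        else Sum.inr ⟨j.1 - 1, by have := j.2; omega⟩))
    p.rel

/-- Rotation of the rightmost upper point to the right end of the lower row
(inverting its color). -/
def rotURdown (p : TCP) (h : 0 < p.k) : TCP where
  k := p.k - 1
  l := p.l + 1
  upColor := fun i => p.upColor ⟨i.1, by have := i.2; omega⟩
  lowColor := fun j =>
    if hj : j.1 < p.l then p.lowColor ⟨j.1, hj⟩
    else !(p.upColor ⟨p.k - 1, by omega⟩)
  rel := Setoid.comap
    (Sum.elim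
      (fun i : Fin (p.k - 1) => (Sum.inl ⟨i.1, by have := i.2; omega⟩ : Fin p.k ⊕ Fin p.l))
      (fun j : Fin (p.l + 1) =>
        if hj : j.1 < p.l then Sum.inr ⟨j.1, hj⟩
        else Sum.inl ⟨p.k - 1, by omega⟩))
    p.rel

/-- Rotation of the leftmost lower point to the left end of the upper row
(inverting its color). -/
def rotULup (p : TCP) (h : 0 < p.l) : TCP where
  k := p.k + 1
  l := p.l - 1
  upColor := fun i =>
    if hi : i.1 = 0 then !(p.lowColor ⟨0, h⟩)
    else p.upColor ⟨i.1 - 1, by have := i.2; omega⟩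
  lowColor := fun j => p.lowColor ⟨j.1 + 1, by have := j.2; omega⟩
  rel := Setoid.comap
    (Sum.elim
      (fun i : Fin (p.k + 1) =>
        if hi : i.1 = 0 then (Sum.inr ⟨0, h⟩ : Fin p.k ⊕ Fin p.l)
        else Sum.inl ⟨i.1 - 1, by have := i.2; omega⟩)
      (fun j : Fin (p.l - 1) => Sum.inr ⟨j.1 + 1, by have := j.2; omega⟩))
    p.rel

/-- Rotation of the rightmost lower point to the right end of the upper row
(inverting its color). -/
def rotURup (p : TCP) (h : 0 < p.l) : TCP where
  k := p.k + 1
  l := p.l - 1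
  upColor := fun i =>
    if hi : i.1 < p.k then p.upColor ⟨i.1, hi⟩
    else !(p.lowColor ⟨p.l - 1, by omega⟩)
  lowColor := fun j => p.lowColor ⟨j.1, by have := j.2; omega⟩
  rel := Setoid.comap
    (Sum.elim
      (fun i : Fin (p.k + 1) =>
        if hi : i.1 < p.k then (Sum.inl ⟨i.1, hi⟩ : Fin p.k ⊕ Fin p.l)
        else Sum.inr ⟨p.l - 1, by omega⟩)
      (fun j : Fin (p.l - 1) => Sum.inr ⟨j.1, by have := j.2; omega⟩))
    p.rel

/-- `p'` is obtained from `p` by rotating an outermost point of one row to the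
corresponding end of the other row, inverting its color. -/
def IsRotationOf (p' p : TCP) : Prop :=
  (∃ h : 0 < p.k, p' = rotULdown p h) ∨ (∃ h : 0 < p.k, p' = rotURdown p h) ∨
  (∃ h : 0 < p.l, p' = rotULup p h) ∨ (∃ h : 0 < p.l, p' = rotURup p h)

/-- A partition with no upper points, given by colors and block labels. -/
def mkLower (n : ℕ) (color : Fin n → Color) (lbl : Fin n → ℕ) : TCP where
  k := 0
  l := n
  upColor := Fin.elim0
  lowColor := color
  rel := Setoid.ker (Sum.elim Fin.elim0 lbl)

/-- The identity partition of color `c`. -/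
def idPart (c : Color) : TCP where
  k := 1
  l := 1
  upColor := fun _ => c
  lowColor := fun _ => c
  rel := ⊤

/-- The pair partition on two lower points of colors `c₁`, `c₂`. -/
def pairLower (c₁ c₂ : Color) : TCP := mkLower 2 ![c₁, c₂] (fun _ => 0)

/-- The singleton of color `c`. -/
def singl (c : Color) : TCP := mkLower 1 (fun _ => c) (fun _ => 0)

/-- `bPart s` : one block on `s` white lower points (`bPart 0` is the empty partition). -/
def bPart (s : ℕ) : TCP := mkLower s (fun _ => white) (fun _ => 0)

/-- One block on four lower points with the given colors. -/
def fourBlock (c₁ c₂ c₃ c₄ : Color) : TCP := mkLower 4 ![c₁, c₂, c₃, c₄] (fun _ => 0)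

/-- The four-block ∘•∘•. -/
def fourWBWB : TCP := fourBlock white black white black

/-- The four-block ∘∘••. -/
def fourWWBB : TCP := fourBlock white white black black

/-- The empty partition. -/
def emptyPart : TCP := mkLower 0 Fin.elim0 Fin.elim0

/-- The partition ∘⊗• (a white and a black singleton). -/
def singPair : TCP := tensor (singl white) (singl black)

/-- The partition ∘∘⊗••. -/
def wwbb : TCP := tensor (pairLower white white) (pairLower black black)

/-- The crossing partition `X` on four white points: first upper point connected to the
second lower point, second upper point connected to the first lower point. -/
def crossPart : TCP where
  k := 2
  l := 2
  upColor := fun _ => white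
  lowColor := fun _ => white
  rel := Setoid.ker (Sum.elim (fun i : Fin 2 => (i.1 : ℕ)) (fun j : Fin 2 => 1 - j.1))

/-- `n`-fold tensor power. -/
def tensorPow (p : TCP) : ℕ → TCP
  | 0 => emptyPart
  | n + 1 => tensor (tensorPow p n) p

/-- The partition `p_d`: from left to right, `d` white singletons, a white point, `d` black
singletons and a black point, the two non-singleton points forming a pair block. -/
def pPart (d : ℕ) : TCP :=
  mkLower (2 * d + 2) (fun j => decide (j.1 ≤ d))
    (fun j => if j.1 = d ∨ j.1 = 2 * d + 1 then 0 else j.1 + 1)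

/-- The partition `p′_r`: from left to right, `r+1` white singletons, a black point, `r−1`
black singletons and a black point, the black non-singleton points forming a pair block;
for `r = 0` the middle consists of one white singleton instead. -/
def pPrime (r : ℕ) : TCP :=
  if r = 0 then
    mkLower 4 ![white, black, white, black]
      (fun j => if j.1 = 1 ∨ j.1 = 3 then 0 else j.1 + 1)
  else
    mkLower (2 * r + 2) (fun j => decide (j.1 ≤ r))
      (fun j => if j.1 = r + 1 ∨ j.1 = 2 * r + 1 then 0 else j.1 + 1)

/-- A category of two-colored partitions: a class of two-colored partitions closed under
tensor products, composition (when defined) and involution, containing both bicolored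
pair partitions and both identity partitions. -/
structure IsCategory (C : Set TCP) : Prop where
  tensor_mem : ∀ p ∈ C, ∀ q ∈ C, tensor p q ∈ C
  comp_mem : ∀ q ∈ C, ∀ p ∈ C, ∀ h : q.l = p.k, ColorsMatch q p h → comp q p h ∈ C
  invol_mem : ∀ p ∈ C, invol p ∈ C
  idw_mem : idPart white ∈ C
  idb_mem : idPart black ∈ C
  pairwb_mem : pairLower white black ∈ C
  pairbw_mem : pairLower black white ∈ C

/-- The smallest category of partitions containing `S`. -/
def generated (S : Set TCP) : Set TCP :=
  {p | ∀ C : Set TCP, IsCategory C → S ⊆ C → p ∈ C}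

/-- `c(p)` : (white lower points + black upper points) − (black lower points + white upper
points). -/
def cval (p : TCP) : ℤ :=
  ((Nat.card {j : Fin p.l // p.lowColor j = white} +
      Nat.card {i : Fin p.k // p.upColor i = black} : ℕ) : ℤ) -
    ((Nat.card {j : Fin p.l // p.lowColor j = black} +
      Nat.card {i : Fin p.k // p.upColor i = white} : ℕ) : ℤ)

/-- Position of a point on the line obtained by rotating all upper points down to the
left of the lower row. -/
def linePos (p : TCP) : (Fin p.k ⊕ Fin p.l) → ℕ :=
  Sum.elim (fun i => p.k - 1 - i.1) (fun j => p.k + j.1)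

/-- A partition is noncrossing if its strings can be drawn without crossings. -/
def Noncrossing (p : TCP) : Prop :=
  ∀ a b x y : Fin p.k ⊕ Fin p.l,
    linePos p a < linePos p b → linePos p b < linePos p x → linePos p x < linePos p y →
    p.rel.r a x → p.rel.r b y → p.rel.r a b

/-- The number of points in the block of the point `x`. -/
def blockSize (p : TCP) (x : Fin p.k ⊕ Fin p.l) : ℕ := Nat.card {y // p.rel.r x y}

/-- The partition obtained from `p` by rotating all upper points down, so that it has no
upper points. -/
def toLine (p : TCP) : TCP where
  k := 0
  l := p.k + p.l
  upColor := Fin.elim0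
  lowColor := fun j =>
    if hj : j.1 < p.k then !(p.upColor ⟨p.k - 1 - j.1, by omega⟩)
    else p.lowColor ⟨j.1 - p.k, by have := j.2; omega⟩
  rel := Setoid.comap
    (Sum.elim (fun i : Fin 0 => (Fin.elim0 i : Fin p.k ⊕ Fin p.l))
      (fun j : Fin (p.k + p.l) =>
        if hj : j.1 < p.k then Sum.inl ⟨p.k - 1 - j.1, by omega⟩
        else Sum.inr ⟨j.1 - p.k, by have := j.2; omega⟩))
    p.rel

def eraseLowRel (p : TCP) (j : ℕ) (hj : j + 1 < p.l) :
    (Fin p.k ⊕ Fin p.l) → (Fin p.k ⊕ Fin p.l) → Prop :=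
  fun x y => p.rel.r x y ∨ (x = Sum.inr ⟨j, by omega⟩ ∧ y = Sum.inr ⟨j + 1, hj⟩)

/-- Erasing the `j`-th and `(j+1)`-th lower points of `p`, first joining their blocks. -/
def eraseLowerPair (p : TCP) (j : ℕ) (hj : j + 1 < p.l) : TCP where
  k := p.k
  l := p.l - 2
  upColor := p.upColor
  lowColor := fun m =>
    if hm : m.1 < j then p.lowColor ⟨m.1, by omega⟩
    else p.lowColor ⟨m.1 + 2, by have := m.2; omega⟩
  rel := Setoid.comap
    (Sum.elim (fun i : Fin p.k => (Sum.inl i : Fin p.k ⊕ Fin p.l))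
      (fun m : Fin (p.l - 2) =>
        if hm : m.1 < j then Sum.inr ⟨m.1, by omega⟩
        else Sum.inr ⟨m.1 + 2, by have := m.2; omega⟩))
    (Relation.EqvGen.setoid (eraseLowRel p j hj))

def eraseUpRel (p : TCP) (j : ℕ) (hj : j + 1 < p.k) :
    (Fin p.k ⊕ Fin p.l) → (Fin p.k ⊕ Fin p.l) → Prop :=
  fun x y => p.rel.r x y ∨ (x = Sum.inl ⟨j, by omega⟩ ∧ y = Sum.inl ⟨j + 1, hj⟩)

/-- Erasing the `j`-th and `(j+1)`-th upper points of `p`, first joining their blocks. -/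
def eraseUpperPair (p : TCP) (j : ℕ) (hj : j + 1 < p.k) : TCP where
  k := p.k - 2
  l := p.l
  upColor := fun m =>
    if hm : m.1 < j then p.upColor ⟨m.1, by omega⟩
    else p.upColor ⟨m.1 + 2, by have := m.2; omega⟩
  lowColor := p.lowColor
  rel := Setoid.comap
    (Sum.elim
      (fun m : Fin (p.k - 2) =>
        if hm : m.1 < j then (Sum.inl ⟨m.1, by omega⟩ : Fin p.k ⊕ Fin p.l)
        else Sum.inl ⟨m.1 + 2, by have := m.2; omega⟩)
      (fun i : Fin p.l => Sum.inr i))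
    (Relation.EqvGen.setoid (eraseUpRel p j hj))

/-- `p₁ ⊗ p₂ ∈ C` is in nest decomposed form, with the first point of `p₂` colored `x`
and the last point of `p₂` colored `y` (and those two points in the same block). -/
def InNDF (C : Set TCP) (x y : Color) (p₁ p₂ : TCP) : Prop :=
  tensor p₁ p₂ ∈ C ∧ Noncrossing (tensor p₁ p₂) ∧ p₁.k = 0 ∧ p₂.k = 0 ∧ 0 < p₁.l ∧
    ∃ h : 2 ≤ p₂.l,
      p₂.lowColor ⟨0, by omega⟩ = x ∧ p₂.lowColor ⟨p₂.l - 1, by omega⟩ = y ∧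
      p₂.rel.r (Sum.inr ⟨0, by omega⟩) (Sum.inr ⟨p₂.l - 1, by omega⟩)

/-- `K^C(x,y)`: the set of values `c(p₁)` over nest decomposed forms `p₁ ⊗ p₂ ∈ C` whose
outer block starts with color `x` and ends with color `y`. -/
def Kset (C : Set TCP) (x y : Color) : Set ℤ :=
  {n | ∃ p₁ p₂, InNDF C x y p₁ p₂ ∧ cval p₁ = n}

/-- The degree of reflection `k(C)`. -/
def kdeg (C : Set TCP) : ℕ := sInf {n : ℕ | 0 < n ∧ ∃ p ∈ C, cval p = (n : ℤ)}

/-- The local parameter `d(C)`. -/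
def ddeg (C : Set TCP) : ℕ := sInf {n : ℕ | 0 < n ∧ (n : ℤ) ∈ Kset C white black}

/-- The local parameter `r(C) = min {t ≥ 1 | t ∈ K^C(•,•)} − 1`. -/
def rdeg (C : Set TCP) : ℕ := sInf {t : ℕ | 1 ≤ t ∧ (t : ℤ) ∈ Kset C black black} - 1

/-- `C` is globally colorized if it contains `∘∘ ⊗ ••`. -/
def GloballyColorized (C : Set TCP) : Prop := wwbb ∈ C

def CaseO (C : Set TCP) : Prop := singPair ∉ C ∧ fourWBWB ∉ C
def CaseB (C : Set TCP) : Prop := singPair ∈ C ∧ fourWBWB ∉ C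
def CaseH (C : Set TCP) : Prop := singPair ∉ C ∧ fourWBWB ∈ C
def CaseS (C : Set TCP) : Prop := singPair ∈ C ∧ fourWBWB ∈ C

/-! Non-colored partitions. -/

/-- A non-colored partition with `k` upper and `l` lower points. -/
structure NCP where
  k : ℕ
  l : ℕ
  rel : Setoid (Fin k ⊕ Fin l)

namespace NCP

def splitPt (p q : NCP) :
    (Fin (p.k + q.k) ⊕ Fin (p.l + q.l)) → ((Fin p.k ⊕ Fin p.l) ⊕ (Fin q.k ⊕ Fin q.l))
  | .inl i => (finSumFinEquiv.symm i).elim (fun a => .inl (.inl a)) (fun b => .inr (.inl b))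
  | .inr j => (finSumFinEquiv.symm j).elim (fun a => .inl (.inr a)) (fun b => .inr (.inr b))

def tensor (p q : NCP) : NCP where
  k := p.k + q.k
  l := p.l + q.l
  rel := Setoid.comap (splitPt p q) (sumSetoid p.rel q.rel)

def compEmbMid (q p : NCP) (h : q.l = p.k) :
    (Fin p.k ⊕ Fin p.l) → ((Fin q.k ⊕ Fin q.l) ⊕ Fin p.l)
  | .inl i => .inl (.inr (Fin.cast h.symm i))
  | .inr j => .inr j

def compRel (q p : NCP) (h : q.l = p.k) :
    ((Fin q.k ⊕ Fin q.l) ⊕ Fin p.l) → ((Fin q.k ⊕ Fin q.l) ⊕ Fin p.l) → Prop :=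
  fun t t' =>
    (∃ x y, q.rel.r x y ∧ t = .inl x ∧ t' = .inl y) ∨
    (∃ x y, p.rel.r x y ∧ t = compEmbMid q p h x ∧ t' = compEmbMid q p h y)

def comp (q p : NCP) (h : q.l = p.k) : NCP where
  k := q.k
  l := p.l
  rel := Setoid.comap
    (Sum.elim (fun i : Fin q.k => (Sum.inl (Sum.inl i) : (Fin q.k ⊕ Fin q.l) ⊕ Fin p.l))
      (fun j : Fin p.l => Sum.inr j))
    (Relation.EqvGen.setoid (compRel q p h))

def invol (p : NCP) : NCP where
  k := p.l
  l := p.k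
  rel := Setoid.comap Sum.swap p.rel

/-- The non-colored identity partition. -/
def idN : NCP := ⟨1, 1, ⊤⟩

/-- The non-colored pair partition on two lower points. -/
def pairN : NCP := ⟨0, 2, ⊤⟩

end NCP

/-- A category of non-colored partitions. -/
structure IsCategoryN (D : Set NCP) : Prop where
  tensor_mem : ∀ p ∈ D, ∀ q ∈ D, NCP.tensor p q ∈ D
  comp_mem : ∀ q ∈ D, ∀ p ∈ D, ∀ h : q.l = p.k, NCP.comp q p h ∈ D
  invol_mem : ∀ p ∈ D, NCP.invol p ∈ D
  id_mem : NCP.idN ∈ D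
  pair_mem : NCP.pairN ∈ D

/-- The map `Ψ` forgetting the colors of a two-colored partition. -/
def forget (p : TCP) : NCP := ⟨p.k, p.l, p.rel⟩

/-! ### Points on the line -/

/-- The color of a point after all upper points have been rotated down. -/
def lineColor (p : TCP) : (Fin p.k ⊕ Fin p.l) → Color :=
  Sum.elim (fun i => !(p.upColor i)) p.lowColor

/-- The point of `p` at a given position of the line. -/
def linePoint (p : TCP) (j : Fin (p.k + p.l)) : Fin p.k ⊕ Fin p.l :=
  if hj : j.1 < p.k then Sum.inl ⟨p.k - 1 - j.1, by omega⟩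
  else Sum.inr ⟨j.1 - p.k, by have := j.2; omega⟩

@[simp]
theorem linePos_inl (p : TCP) (i : Fin p.k) : linePos p (.inl i) = p.k - 1 - i.1 := rfl

@[simp]
theorem linePos_inr (p : TCP) (j : Fin p.l) : linePos p (.inr j) = p.k + j.1 := rfl

theorem linePos_linePoint (p : TCP) (j : Fin (p.k + p.l)) : linePos p (linePoint p j) = j := by
  unfold linePoint
  split_ifs with hj
  · simp
    omega
  · simp
    omega

theorem linePos_lt (p : TCP) (x : Fin p.k ⊕ Fin p.l) : linePos p x < p.k + p.l := by
  rcases x with i | j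
  · rw [linePos_inl]
    omega
  · rw [linePos_inr]
    omega

theorem linePos_injective (p : TCP) : Function.Injective (linePos p) := by
  rintro (i | i) (j | j) h <;> (simp [Fin.ext_iff] at h ⊢; omega)

theorem linePoint_linePos (p : TCP) (x : Fin p.k ⊕ Fin p.l) :
    linePoint p ⟨linePos p x, linePos_lt p x⟩ = x :=
  linePos_injective p (linePos_linePoint p _)

theorem toLine_lowColor (p : TCP) (j : Fin (p.k + p.l)) :
    (toLine p).lowColor j = lineColor p (linePoint p j) := by
  simp only [toLine, linePoint]
  split_ifs <;> rfl

/-- Equality of two-colored partitions, checked on points given by natural numbers. -/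
theorem TCP.eq_of {p q : TCP} (hk : p.k = q.k) (hl : p.l = q.l)
    (hu : ∀ i (h : i < p.k) (h' : i < q.k), p.upColor ⟨i, h⟩ = q.upColor ⟨i, h'⟩)
    (hd : ∀ i (h : i < p.l) (h' : i < q.l), p.lowColor ⟨i, h⟩ = q.lowColor ⟨i, h'⟩)
    (huu : ∀ i j (h : i < p.k) (h' : i < q.k) (g : j < p.k) (g' : j < q.k),
      p.rel.r (.inl ⟨i, h⟩) (.inl ⟨j, g⟩) ↔ q.rel.r (.inl ⟨i, h'⟩) (.inl ⟨j, g'⟩))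
    (hud : ∀ i j (h : i < p.k) (h' : i < q.k) (g : j < p.l) (g' : j < q.l),
      p.rel.r (.inl ⟨i, h⟩) (.inr ⟨j, g⟩) ↔ q.rel.r (.inl ⟨i, h'⟩) (.inr ⟨j, g'⟩))
    (hdd : ∀ i j (h : i < p.l) (h' : i < q.l) (g : j < p.l) (g' : j < q.l),
      p.rel.r (.inr ⟨i, h⟩) (.inr ⟨j, g⟩) ↔ q.rel.r (.inr ⟨i, h'⟩) (.inr ⟨j, g'⟩)) :
    p = q := by
  rcases p with ⟨k, l, up, low, r⟩
  rcases q with ⟨k', l', up', low', r'⟩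
  dsimp only at hk hl
  subst hk hl
  obtain rfl : up = up' := funext fun i => hu i.1 i.2 i.2
  obtain rfl : low = low' := funext fun i => hd i.1 i.2 i.2
  obtain rfl : r = r' := by
    refine Setoid.ext ?_
    rintro (i | i) (j | j)
    · exact huu i.1 j.1 i.2 i.2 j.2 j.2
    · exact hud i.1 j.1 i.2 i.2 j.2 j.2
    · exact ⟨fun h => r'.symm' ((hud j.1 i.1 j.2 j.2 i.2 i.2).1 (r.symm' h)),
        fun h => r.symm' ((hud j.1 i.1 j.2 j.2 i.2 i.2).2 (r'.symm' h))⟩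
    · exact hdd i.1 j.1 i.2 i.2 j.2 j.2
  rfl

/-! ### Noncrossing bicolored pairings -/

/-- The blocks of `r` are pairs of points of opposite colors, and no two of them cross with
respect to the positions `pos`. -/
structure IsPairing {X : Type*} (pos : X → ℕ) (col : X → Color) (r : Setoid X) : Prop where
  noncrossing : ∀ a b x y, pos a < pos b → pos b < pos x → pos x < pos y →
    r.r a x → r.r b y → r.r a b
  exists_partner : ∀ x, ∃ y, y ≠ x ∧ r.r x y ∧ ∀ z, r.r x z → z = x ∨ z = y
  color_eq : ∀ x y, r.r x y → x ≠ y → col x = !(col y)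

/-- Noncrossing pair partitions all of whose blocks connect points of opposite colors,
after rotating all points to the lower row. -/
def IsBicoloredPairing (p : TCP) : Prop := IsPairing (linePos p) (lineColor p) p.rel

theorem blockSize_eq_two_iff (p : TCP) (x : Fin p.k ⊕ Fin p.l) :
    blockSize p x = 2 ↔ ∃ y, y ≠ x ∧ p.rel.r x y ∧ ∀ z, p.rel.r x z → z = x ∨ z = y := by
  unfold blockSize
  have hx : p.rel.r x x := p.rel.refl' x
  rw [Nat.card_eq_two_iff' (⟨x, hx⟩ : {y // p.rel.r x y})]
  constructor
  · rintro ⟨⟨y, hy⟩, hne, huniq⟩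
    refine ⟨y, fun h => hne (Subtype.ext h), hy, fun z hz => ?_⟩
    by_cases h : z = x
    · exact .inl h
    · exact .inr (congrArg Subtype.val (huniq ⟨z, hz⟩ fun h' => h (congrArg Subtype.val h')))
  · rintro ⟨y, hne, hy, huniq⟩
    refine ⟨⟨y, hy⟩, fun h => hne (congrArg Subtype.val h), ?_⟩
    rintro ⟨z, hz⟩ hzx
    exact Subtype.ext ((huniq z hz).resolve_left fun h => hzx (Subtype.ext h))

theorem isBicoloredPairing_iff (p : TCP) :
    IsBicoloredPairing p ↔ Noncrossing p ∧ (∀ x : Fin p.k ⊕ Fin p.l, blockSize p x = 2) ∧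
      ∀ j j' : Fin (toLine p).l, (toLine p).rel.r (Sum.inr j) (Sum.inr j') → j ≠ j' →
        (toLine p).lowColor j = !((toLine p).lowColor j') := by
  have key : (∀ j j' : Fin (toLine p).l, (toLine p).rel.r (Sum.inr j) (Sum.inr j') → j ≠ j' →
        (toLine p).lowColor j = !((toLine p).lowColor j')) ↔
      ∀ x y, p.rel.r x y → x ≠ y → lineColor p x = !(lineColor p y) := by
    change (∀ j j' : Fin (p.k + p.l), p.rel.r (linePoint p j) (linePoint p j') → j ≠ j' →
        (toLine p).lowColor j = !((toLine p).lowColor j')) ↔ _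
    constructor
    · intro H x y hxy hne
      have := H ⟨linePos p x, linePos_lt p x⟩ ⟨linePos p y, linePos_lt p y⟩
      rw [toLine_lowColor p, toLine_lowColor p, linePoint_linePos, linePoint_linePos] at this
      exact this hxy fun h => hne (linePos_injective p (congrArg Fin.val h))
    · intro H j j' hjj hne
      rw [toLine_lowColor p, toLine_lowColor p]
      refine H _ _ hjj fun h => hne (Fin.ext ?_)
      have h' := congrArg (linePos p) h
      rwa [linePos_linePoint, linePos_linePoint] at h'
  rw [key]
  constructor
  · rintro ⟨h₁, h₂, h₃⟩
    exact ⟨h₁, fun x => (blockSize_eq_two_iff p x).2 (h₂ x), h₃⟩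
  · rintro ⟨h₁, h₂, h₃⟩
    exact ⟨h₁, fun x => (blockSize_eq_two_iff p x).1 (h₂ x), h₃⟩

namespace IsPairing

variable {X Y : Type*} {pos : X → ℕ} {col : X → Color} {r : Setoid X}
  {pos' : Y → ℕ} {col' : Y → Color} {r' : Setoid Y}

theorem eq_of_rel (hp : IsPairing pos col r) {x y z : X} (hxy : r.r x y) (hne : y ≠ x)
    (hxz : r.r x z) (hzx : z ≠ x) : z = y := by
  obtain ⟨w, -, -, hw⟩ := hp.exists_partner x
  rw [(hw y hxy).resolve_left hne, (hw z hxz).resolve_left hzx]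

/-- The restriction of a pairing to a union of blocks is a pairing. -/
theorem of_embedding (hp : IsPairing pos' col' r') (e : X → Y) (hinj : Function.Injective e)
    (hmono : ∀ x y, pos x < pos y → pos' (e x) < pos' (e y))
    (hcolor : ∀ x, col x = col' (e x)) (hrel : ∀ x y, r.r x y ↔ r'.r (e x) (e y))
    (hsat : ∀ x z, r'.r (e x) z → ∃ y, e y = z) : IsPairing pos col r := by
  refine ⟨?_, ?_, ?_⟩
  · intro a b x y hab hbx hxy h₁ h₂
    rw [hrel] at h₁ h₂ ⊢
    exact hp.noncrossing _ _ _ _ (hmono _ _ hab) (hmono _ _ hbx) (hmono _ _ hxy) h₁ h₂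
  · intro x
    obtain ⟨y, hne, hxy, hy⟩ := hp.exists_partner (e x)
    obtain ⟨y, rfl⟩ := hsat x y hxy
    refine ⟨y, fun h => hne (by rw [h]), (hrel _ _).2 hxy, fun z hz => ?_⟩
    rcases hy _ ((hrel _ _).1 hz) with h | h
    · exact .inl (hinj h)
    · exact .inr (hinj h)
  · intro x y hxy hne
    rw [hcolor, hcolor]
    exact hp.color_eq _ _ ((hrel _ _).1 hxy) fun h => hne (hinj h)

/-- Reading a pairing backwards with inverted colors gives a pairing. -/
theorem reverse (hp : IsPairing pos col r) {rev : X → ℕ}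
    (hrev : ∀ x y, rev x < rev y → pos y < pos x) : IsPairing rev (fun x => !(col x)) r := by
  refine ⟨?_, hp.exists_partner, fun x y hxy hne => congrArg _ (hp.color_eq x y hxy hne)⟩
  intro a b x y hab hbx hxy h₁ h₂
  have h := hp.noncrossing y x b a (hrev _ _ hxy) (hrev _ _ hbx) (hrev _ _ hab)
    (r.symm' h₂) (r.symm' h₁)
  exact r.trans' h₁ (r.trans' (r.symm' h) (r.symm' h₂))

/-- Nesting one pairing into a gap of another gives a pairing. -/
theorem nest (hp : IsPairing pos col r) (hp' : IsPairing pos' col' r') {f : X ⊕ Y → ℕ}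
    (hX : ∀ x y, f (.inl x) < f (.inl y) → pos x < pos y)
    (hY : ∀ x y, f (.inr x) < f (.inr y) → pos' x < pos' y)
    (hXY : ∀ x y z, f (.inl x) < f (.inr y) → ¬ f (.inr y) < f (.inl z)) :
    IsPairing f (Sum.elim col col') (sumSetoid r r') := by
  refine ⟨?_, ?_, ?_⟩
  · rintro (a | a) (b | b) (x | x) (y | y) hab hbx hxy h₁ h₂
    all_goals first
      | exact h₁.elim
      | exact h₂.elim
      | exact hp.noncrossing a b x y (hX _ _ hab) (hX _ _ hbx) (hX _ _ hxy) h₁ h₂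
      | exact hp'.noncrossing a b x y (hY _ _ hab) (hY _ _ hbx) (hY _ _ hxy) h₁ h₂
      | exact (hXY _ _ _ hab hbx).elim
      | exact (hXY _ _ _ hbx hxy).elim
  · rintro (x | x)
    · obtain ⟨y, hne, hxy, hy⟩ := hp.exists_partner x
      refine ⟨.inl y, by simpa using hne, hxy, ?_⟩
      rintro (z | z) hz
      · simpa using hy z hz
      · exact hz.elim
    · obtain ⟨y, hne, hxy, hy⟩ := hp'.exists_partner x
      refine ⟨.inr y, by simpa using hne, hxy, ?_⟩
      rintro (z | z) hz
      · exact hz.elim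
      · simpa using hy z hz
  · rintro (x | x) (y | y) hxy hne
    · exact hp.color_eq x y hxy fun h => hne (congrArg _ h)
    · exact hxy.elim
    · exact hxy.elim
    · exact hp'.color_eq x y hxy fun h => hne (congrArg _ h)

end IsPairing

/-! ### Closure under the generators, tensor products and involution -/

theorem isBicoloredPairing_idPart (c : Color) : IsBicoloredPairing (idPart c) := by
  change IsPairing (X := Fin 1 ⊕ Fin 1) (linePos (idPart c))
    (Sum.elim (fun _ => !c) fun _ => c) ⊤
  refine ⟨fun _ _ _ _ _ _ _ _ _ => trivial, ?_, ?_⟩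
  · intro x
    refine ⟨x.swap, ?_, trivial, fun z hz => ?_⟩
    · revert x
      decide
    · clear hz
      revert x z
      decide
  · rintro (i | i) (j | j) - hne
    · exact absurd (congrArg _ (Subsingleton.elim _ _)) hne
    · rfl
    · exact (Bool.not_not c).symm
    · exact absurd (congrArg _ (Subsingleton.elim _ _)) hne

theorem isBicoloredPairing_pairLower (c : Color) : IsBicoloredPairing (pairLower c !c) := by
  have htop : (Setoid.ker (Sum.elim Fin.elim0 fun _ : Fin 2 => 0)) = ⊤ := by
    refine Setoid.ext ?_
    rintro (i | i) (j | j)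
    · exact i.elim0
    · exact i.elim0
    · exact j.elim0
    · exact iff_of_true rfl trivial
  change IsPairing (X := Fin 0 ⊕ Fin 2) (linePos (pairLower c !c))
    (Sum.elim (fun i => !(Fin.elim0 i)) ![c, !c]) (Setoid.ker (Sum.elim Fin.elim0 fun _ => 0))
  rw [htop]
  refine ⟨fun _ _ _ _ _ _ _ _ _ => trivial, ?_, ?_⟩
  · intro x
    refine ⟨x.map id Fin.rev, ?_, trivial, fun z hz => ?_⟩
    · revert x
      decide
    · clear hz
      revert x z
      decide
  · rintro (i | i) (j | j) - hne
    · exact i.elim0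
    · exact i.elim0
    · exact j.elim0
    · have hne : i ≠ j := fun h => hne (congrArg _ h)
      fin_cases i <;> fin_cases j <;> simp at hne ⊢

theorem IsBicoloredPairing.invol {p : TCP} (hp : IsBicoloredPairing p) :
    IsBicoloredPairing (invol p) := by
  have hrev := IsPairing.reverse hp (rev := fun x => p.k + p.l - 1 - linePos p x)
    (fun x y h => by omega)
  refine IsPairing.of_embedding hrev (X := Fin p.l ⊕ Fin p.k) Sum.swap
    Sum.swap_leftInverse.injective ?_ ?_ (fun _ _ => Iff.rfl) fun x z _ => ⟨z.swap, by simp⟩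
  · have hpos : ∀ x : Fin p.l ⊕ Fin p.k,
        linePos (CTCP.invol p) x = p.k + p.l - 1 - linePos p x.swap := by
      rintro (i | i)
      · change p.l - 1 - i.1 = p.k + p.l - 1 - (p.k + i.1)
        omega
      · change p.l + i.1 = p.k + p.l - 1 - (p.k - 1 - i.1)
        omega
    intro x y h
    rwa [← hpos, ← hpos]
  · rintro (i | i)
    · rfl
    · exact (Bool.not_not _).symm

/-- The inverse of `splitPt`. -/
def joinPt (p q : TCP) :
    ((Fin p.k ⊕ Fin p.l) ⊕ (Fin q.k ⊕ Fin q.l)) → Fin (p.k + q.k) ⊕ Fin (p.l + q.l)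
  | .inl (.inl a) => .inl (Fin.castAdd q.k a)
  | .inl (.inr a) => .inr (Fin.castAdd q.l a)
  | .inr (.inl a) => .inl (Fin.natAdd p.k a)
  | .inr (.inr a) => .inr (Fin.natAdd p.l a)

theorem splitPt_joinPt (p q : TCP) (x) : splitPt p q (joinPt p q x) = x := by
  rcases x with (x | x) | (x | x) <;> simp [joinPt, splitPt]

theorem joinPt_splitPt (p q : TCP) (x) : joinPt p q (splitPt p q x) = x := by
  rcases x with x | x <;> refine Fin.addCases (fun i => ?_) (fun i => ?_) x <;>
    simp [joinPt, splitPt]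

theorem IsBicoloredPairing.tensor {p q : TCP} (hp : IsBicoloredPairing p)
    (hq : IsBicoloredPairing q) : IsBicoloredPairing (tensor p q) := by
  have hnest := IsPairing.nest hp hq
    (f := Sum.elim (fun x => linePos p x + q.k)
      (Sum.elim (fun i => q.k - 1 - i.1) fun j => p.k + p.l + q.k + j.1)) ?_ ?_ ?_
  · refine IsPairing.of_embedding hnest (X := Fin (p.k + q.k) ⊕ Fin (p.l + q.l)) (splitPt p q)
      (Function.LeftInverse.injective (joinPt_splitPt p q)) ?_ ?_ (fun _ _ => Iff.rfl)
      fun x z _ => ⟨joinPt p q z, splitPt_joinPt p q z⟩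
    · have hpos : ∀ x, linePos (CTCP.tensor p q) (joinPt p q x) =
          Sum.elim (fun x => linePos p x + q.k)
            (Sum.elim (fun i => q.k - 1 - i.1) fun j => p.k + p.l + q.k + j.1) x := by
        rintro ((x | x) | (x | x))
        · change p.k + q.k - 1 - x.1 = p.k - 1 - x.1 + q.k
          omega
        · change p.k + q.k + x.1 = p.k + x.1 + q.k
          omega
        · change p.k + q.k - 1 - (p.k + x.1) = q.k - 1 - x.1
          omega
        · change p.k + q.k + (p.l + x.1) = p.k + p.l + q.k + x.1
          omega
      intro x y h
      rwa [← hpos, ← hpos, joinPt_splitPt, joinPt_splitPt]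
    · rintro (x | x)
      · change (!((finSumFinEquiv.symm x).elim p.upColor q.upColor)) = _
        refine Fin.addCases (fun i => ?_) (fun i => ?_) x <;> simp [splitPt, lineColor]
      · change (finSumFinEquiv.symm x).elim p.lowColor q.lowColor = _
        refine Fin.addCases (fun i => ?_) (fun i => ?_) x <;> simp [splitPt, lineColor]
  · intro x y h
    simpa using h
  · rintro (x | x) (y | y) h <;> simp at h ⊢ <;> omega
  · intro x y z
    have := linePos_lt p x
    have := linePos_lt p z
    rcases y with y | y <;> simp <;> omega

/-! ### Closure under composition -/

namespace IsPairing

variable {X : Type*} {pos : X → ℕ} {col : X → Color} {r : Setoid X}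

/-- A weighted sum over a union of blocks vanishes if the weights cancel in each block. -/
theorem sum_mul_eq_zero [Fintype X] {R : Type*} [CommRing R] (hp : IsPairing pos col r)
    (α w : X → R) (hα : ∀ x y, r.r x y → α x = α y)
    (hw : ∀ x y, r.r x y → x ≠ y → α x ≠ 0 → w x + w y = 0) : ∑ x, α x * w x = 0 := by
  classical
  choose f hne hf hf' using hp.exists_partner
  have hff : ∀ x, f (f x) = x := fun x =>
    ((hf' (f x) x (r.symm' (hf x))).resolve_left (hne x).symm).symm
  refine Finset.sum_involution (fun x _ => f x) (fun x _ => ?_) (fun x _ _ => hne x)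
    (fun _ _ => Finset.mem_univ _) (fun x _ => hff x)
  rw [← hα x (f x) (hf x), ← mul_add]
  by_cases h : α x = 0
  · rw [h, zero_mul]
  · rw [hw x (f x) (hf x) (hne x).symm h, mul_zero]

/-- Two disjoint unions of blocks of a noncrossing pairing have even crossing number. -/
theorem sum_crossing_eq_zero [Fintype X] (hp : IsPairing pos col r)
    (hpos : Function.Injective pos) (α β : X → ZMod 2)
    (hα : ∀ x y, r.r x y → α x = α y) (hβ : ∀ x y, r.r x y → β x = β y)
    (hαβ : ∀ x, α x = 0 ∨ β x = 0) :
    ∑ x, α x * ∑ y, β y * (if pos x < pos y then 1 else 0) = 0 := by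
  refine hp.sum_mul_eq_zero α _ hα fun x x' hx hxne hαx => ?_
  rw [← Finset.sum_add_distrib]
  simp_rw [← mul_add]
  refine hp.sum_mul_eq_zero β _ hβ fun y y' hy hyne hβy => ?_
  have hxy : ¬ r.r x y := fun h =>
    hβy (by rw [← hβ x y h, (hαβ x).resolve_left hαx])
  have hne : ∀ a b, r.r x a → r.r y b → pos a ≠ pos b := fun a b ha hb h =>
    hxy (r.trans' ha (hpos h ▸ r.symm' hb))
  have hnc : ∀ a a' b b', r.r x a → r.r x a' → r.r y b → r.r y b' →
      ¬ (pos a < pos b ∧ pos b < pos a' ∧ pos a' < pos b') := fun a a' b b' ha ha' hb hb' h =>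
    hxy (r.trans' ha (r.trans' (hp.noncrossing a b a' b' h.1 h.2.1 h.2.2
      (r.trans' (r.symm' ha) ha') (r.trans' (r.symm' hb) hb')) (r.symm' hb)))
  have hnc' : ∀ a a' b b', r.r x a → r.r x a' → r.r y b → r.r y b' →
      ¬ (pos b < pos a ∧ pos a < pos b' ∧ pos b' < pos a') := fun a a' b b' ha ha' hb hb' h =>
    hxy (r.trans' ha (r.trans' (r.symm' (hp.noncrossing b a b' a' h.1 h.2.1 h.2.2
      (r.trans' (r.symm' hb) hb') (r.trans' (r.symm' ha) ha'))) (r.symm' hb)))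
  have hxx := r.refl' x
  have hyy := r.refl' y
  have h₁ := hne x y hxx hyy
  have h₂ := hne x y' hxx hy
  have h₃ := hne x' y hx hyy
  have h₄ := hne x' y' hx hy
  have h₅ := hnc x x' y y' hxx hx hyy hy
  have h₆ := hnc x x' y' y hxx hx hy hyy
  have h₇ := hnc x' x y y' hx hxx hyy hy
  have h₈ := hnc x' x y' y hx hxx hy hyy
  have h₅' := hnc' x x' y y' hxx hx hyy hy
  have h₆' := hnc' x x' y' y hxx hx hy hyy
  have h₇' := hnc' x' x y y' hx hxx hyy hy
  have h₈' := hnc' x' x y' y hx hxx hy hyy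
  split_ifs <;> first | rfl | (exfalso; omega)

end IsPairing

/-- A connected graph of maximal degree two has at most two vertices of degree at most one. -/
theorem card_le_two_of_connected {V : Type*} [Fintype V] (G : SimpleGraph V)
    (hG : G.Connected) (O : Finset V) (hdeg : ∀ v, (G.neighborSet v).ncard ≤ 2)
    (hO : ∀ v ∈ O, (G.neighborSet v).ncard ≤ 1) : O.card ≤ 2 := by
  classical
  have hcard := hG.card_vert_le_card_edgeSet_add_one
  have hsum := G.sum_degrees_eq_twice_card_edges
  have hdeg' : ∀ v, G.degree v = (G.neighborSet v).ncard := fun v => by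
    rw [← G.card_neighborSet_eq_degree, ← Nat.card_eq_fintype_card, Nat.card_coe_set_eq]
  have hbound : ∑ v, (G.degree v + if v ∈ O then 1 else 0) ≤ ∑ _v : V, 2 := by
    refine Finset.sum_le_sum fun v _ => ?_
    rw [hdeg']
    split_ifs with h
    · have := hO v h
      omega
    · exact hdeg v
  rw [Finset.sum_add_distrib, hsum] at hbound
  simp at hbound
  rw [Nat.card_eq_fintype_card, Nat.card_eq_fintype_card, ← SimpleGraph.edgeFinset_card] at hcard
  omega

/-- In a component of a graph each vertex `v` of which is adjacent to at most `f v` and `g v`,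
there are at most two vertices fixed by `f` or `g`. -/
theorem card_fixed_le_two {V : Type*} [Fintype V] (G : SimpleGraph V) (f g : V → V)
    (hadj : ∀ v w, G.Adj v w → w = f v ∨ w = g v) (u : V) (O : Finset V)
    (hO : ∀ v ∈ O, G.Reachable u v ∧ (f v = v ∨ g v = v)) : O.card ≤ 2 := by
  classical
  set c := G.connectedComponentMk u with hc
  have hmem : ∀ v ∈ O, v ∈ c.supp := fun v hv => by
    rw [SimpleGraph.ConnectedComponent.mem_supp_iff, hc, SimpleGraph.ConnectedComponent.eq]
    exact (hO v hv).1.symm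
  have hle := card_le_two_of_connected c.toSimpleGraph c.connected_toSimpleGraph
    (O.subtype (· ∈ c.supp)) (fun v => ?_) (fun v hv => ?_)
  · rwa [Finset.card_subtype, Finset.filter_true_of_mem hmem] at hle
  · rw [← Set.ncard_image_of_injective _ Subtype.val_injective]
    refine (Set.ncard_le_ncard (t := {f v, g v}) ?_).trans
      ((Set.ncard_insert_le _ _).trans (by rw [Set.ncard_singleton]))
    rintro _ ⟨w, hw, rfl⟩
    exact hadj v w hw
  · rw [← Set.ncard_image_of_injective _ Subtype.val_injective]
    have hfix := (hO v (by simpa using hv)).2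
    rcases hfix with h | h
    · refine (Set.ncard_le_ncard (t := {g v}) ?_).trans (Set.ncard_singleton _).le
      rintro _ ⟨w, hw, rfl⟩
      have hw : G.Adj v w := hw
      exact (hadj v w hw).resolve_left fun h' => hw.ne (h' ▸ h).symm
    · refine (Set.ncard_le_ncard (t := {f v}) ?_).trans (Set.ncard_singleton _).le
      rintro _ ⟨w, hw, rfl⟩
      have hw : G.Adj v w := hw
      exact (hadj v w hw).resolve_right fun h' => hw.ne (h' ▸ h).symm

/-- The sign of a color. -/
def colorSign (c : Color) : ℤ := if c then 1 else -1

theorem colorSign_not (c : Color) : colorSign (!c) = -colorSign c := by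
  cases c <;> rfl

theorem colorSign_add_eq_zero_iff (c d : Color) : colorSign c + colorSign d = 0 ↔ c = !d := by
  cases c <;> cases d <;> decide

/-- Linear position of the points of a partition with `k` upper and `l` lower points. -/
def rowPos (k l : ℕ) : Fin k ⊕ Fin l → ℕ :=
  Sum.elim (fun i => k - 1 - i.1) (fun j => k + j.1)

theorem rowPos_injective (k l : ℕ) : Function.Injective (rowPos k l) := by
  rintro (i | i) (j | j) h <;> (simp [rowPos, Fin.ext_iff] at h ⊢; omega)

/-- Colors of the points of a partition after rotating them all to the lower row. -/
def rowColor {k l : ℕ} (up : Fin k → Color) (low : Fin l → Color) : Fin k ⊕ Fin l → Color :=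
  Sum.elim (fun i => !(up i)) low

section Gluing

variable {k n m : ℕ}

/-- The points of the lower diagram inside the glued diagram. -/
def lowerEmb : Fin n ⊕ Fin m → (Fin k ⊕ Fin n) ⊕ Fin m :=
  Sum.elim (fun j => .inl (.inr j)) .inr

/-- The outer points of the glued diagram. -/
def outerEmb : Fin k ⊕ Fin m → (Fin k ⊕ Fin n) ⊕ Fin m :=
  Sum.elim (fun i => .inl (.inl i)) .inr

theorem outerEmb_injective :
    Function.Injective (outerEmb : Fin k ⊕ Fin m → (Fin k ⊕ Fin n) ⊕ Fin m) := by
  rintro (i | i) (j | j) h <;> simp_all [outerEmb]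

variable {up : Fin k → Color} {mid : Fin n → Color} {low : Fin m → Color}
  {r : Setoid (Fin k ⊕ Fin n)} {s : Setoid (Fin n ⊕ Fin m)}

theorem sum_outer_color_eq_zero (hr : IsPairing (rowPos k n) (rowColor up mid) r)
    (hs : IsPairing (rowPos n m) (rowColor mid low) s) (α : (Fin k ⊕ Fin n) ⊕ Fin m → ℤ)
    (hαr : ∀ x y, r.r x y → α (.inl x) = α (.inl y))
    (hαs : ∀ x y, s.r x y → α (lowerEmb x) = α (lowerEmb y)) :
    ∑ x, α (outerEmb x) * colorSign (rowColor up low x) = 0 := by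
  have h₁ := hr.sum_mul_eq_zero (fun x => α (.inl x)) (fun x => colorSign (rowColor up mid x)) hαr
    fun x y hxy hne _ => (colorSign_add_eq_zero_iff _ _).2 (hr.color_eq x y hxy hne)
  have h₂ := hs.sum_mul_eq_zero (fun x => α (lowerEmb x))
    (fun x => colorSign (rowColor mid low x)) hαs
    fun x y hxy hne _ => (colorSign_add_eq_zero_iff _ _).2 (hs.color_eq x y hxy hne)
  simp only [Fintype.sum_sum_type, rowColor, Sum.elim_inl, Sum.elim_inr, lowerEmb, outerEmb,
    colorSign_not, mul_neg, Finset.sum_neg_distrib] at h₁ h₂ ⊢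
  linarith

theorem sum_outer_crossing_eq_zero (hr : IsPairing (rowPos k n) (rowColor up mid) r)
    (hs : IsPairing (rowPos n m) (rowColor mid low) s) (α β : (Fin k ⊕ Fin n) ⊕ Fin m → ZMod 2)
    (hαr : ∀ x y, r.r x y → α (.inl x) = α (.inl y))
    (hαs : ∀ x y, s.r x y → α (lowerEmb x) = α (lowerEmb y))
    (hβr : ∀ x y, r.r x y → β (.inl x) = β (.inl y))
    (hβs : ∀ x y, s.r x y → β (lowerEmb x) = β (lowerEmb y))
    (hαβ : ∀ x, α x = 0 ∨ β x = 0) :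
    ∑ x, α (outerEmb x) * ∑ y, β (outerEmb y) *
      (if rowPos k m x < rowPos k m y then 1 else 0) = 0 := by
  have h₁ := hr.sum_crossing_eq_zero (rowPos_injective k n) (fun x => α (.inl x))
    (fun x => β (.inl x)) hαr hβr fun x => hαβ _
  have h₂ := hs.sum_crossing_eq_zero (rowPos_injective n m) (fun x => α (lowerEmb x))
    (fun x => β (lowerEmb x)) hαs hβs fun x => hαβ _
  have h₃ := hs.sum_mul_eq_zero (fun x => β (lowerEmb x)) (fun _ => 1) hβs fun _ _ _ _ _ => rfl
  have hlt : ∀ (a b : ℕ) (i : Fin a) (j : Fin b), (a - 1 - i.1 < a + j.1) = True :=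
    fun a b i j => eq_true (by omega)
  have hgt : ∀ (a b : ℕ) (i : Fin a) (j : Fin b), (a + j.1 < a - 1 - i.1) = False :=
    fun a b i j => eq_false (by omega)
  have hrev : ∀ (a : ℕ) (i j : Fin a), (a - 1 - i.1 < a - 1 - j.1) = (j.1 < i.1) :=
    fun a i j => propext (by omega)
  have hmid : ∑ i : Fin n, α (.inl (.inr i)) *
        ∑ j : Fin n, β (.inl (.inr j)) * (if i.1 < j.1 then 1 else 0) +
      ∑ i : Fin n, α (.inl (.inr i)) *
        ∑ j : Fin n, β (.inl (.inr j)) * (if j.1 < i.1 then 1 else 0) =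
      (∑ i : Fin n, α (.inl (.inr i))) * ∑ j : Fin n, β (.inl (.inr j)) := by
    rw [← Finset.sum_add_distrib, Finset.sum_mul]
    refine Finset.sum_congr rfl fun i _ => ?_
    rw [← mul_add, ← Finset.sum_add_distrib]
    rcases eq_or_ne (α (.inl (.inr i))) 0 with h | h
    · rw [h, zero_mul, zero_mul]
    congr 1
    refine Finset.sum_congr rfl fun j _ => ?_
    rcases eq_or_ne i j with rfl | hij
    · simp [(hαβ _).resolve_left h]
    · have hij' : i.1 ≠ j.1 := fun h => hij (Fin.ext h)
      rw [← mul_add]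
      split_ifs <;> first | (exfalso; omega) | simp
  simp only [Fintype.sum_sum_type, rowPos, Sum.elim_inl, Sum.elim_inr, lowerEmb, outerEmb,
    hlt, hgt, hrev, if_true, if_false, mul_one, mul_zero, Finset.sum_const_zero,
    Nat.add_lt_add_iff_left, mul_add, Finset.sum_add_distrib, ← Finset.sum_mul] at h₁ h₂ h₃ ⊢
  have h2 : (2 : ZMod 2) = 0 := rfl
  linear_combination h₁ + h₂ - hmid + (∑ i : Fin k, α (.inl (.inl i))) * h₃ -
    (∑ i : Fin n, α (.inl (.inr i))) * h₃ -
    (∑ i : Fin k, α (.inl (.inl i))) * (∑ i : Fin n, β (.inl (.inr i))) * h2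

/-- Gluing two pairings along their middle points gives a pairing, provided that each
component of the glued diagram has at most two outer points. -/
theorem isPairing_glue (hr : IsPairing (rowPos k n) (rowColor up mid) r)
    (hs : IsPairing (rowPos n m) (rowColor mid low) s) (E : Setoid ((Fin k ⊕ Fin n) ⊕ Fin m))
    (hEr : ∀ x y, r.r x y → E.r (.inl x) (.inl y))
    (hEs : ∀ x y, s.r x y → E.r (lowerEmb x) (lowerEmb y))
    (hcard : ∀ (u : Fin k ⊕ Fin m) (O : Finset (Fin k ⊕ Fin m)),
      (∀ v ∈ O, E.r (outerEmb u) (outerEmb v)) → O.card ≤ 2) :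
    IsPairing (rowPos k m) (rowColor up low) (E.comap outerEmb) := by
  classical
  have hind : ∀ {R : Type} [Zero R] [One R] (u v w), E.r v w →
      (if E.r u v then (1 : R) else 0) = if E.r u w then 1 else 0 := fun u v w h =>
    if_congr ⟨fun h' => E.trans' h' h, fun h' => E.trans' h' (E.symm' h)⟩ rfl rfl
  set F : Fin k ⊕ Fin m → Finset (Fin k ⊕ Fin m) :=
    fun u => Finset.univ.filter fun v => E.r (outerEmb u) (outerEmb v) with hF
  have hmem : ∀ u v, v ∈ F u ↔ E.r (outerEmb u) (outerEmb v) := by simp [hF]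
  have hself : ∀ u, u ∈ F u := fun u => (hmem u u).2 (E.refl' _)
  have hfil : ∀ {R : Type} [CommRing R] (u) (w : Fin k ⊕ Fin m → R),
      ∑ v, (if E.r (outerEmb u) (outerEmb v) then (1 : R) else 0) * w v = ∑ v ∈ F u, w v :=
    fun u w => by simp only [ite_mul, one_mul, zero_mul, ← Finset.sum_filter, hF]
  have hsum : ∀ u, ∑ v ∈ F u, colorSign (rowColor up low v) = 0 := fun u => by
    have h := sum_outer_color_eq_zero hr hs (fun v => if E.r (outerEmb u) v then 1 else 0)
      (fun x y hxy => hind _ _ _ (hEr x y hxy)) (fun x y hxy => hind _ _ _ (hEs x y hxy))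
    rwa [hfil] at h
  have hpair : ∀ u v, v ∈ F u → u ≠ v → F u = {u, v} := fun u v hv hne => by
    refine (Finset.eq_of_subset_of_card_le ?_ ?_).symm
    · intro w hw
      rcases Finset.mem_insert.1 hw with rfl | hw
      · exact hself _
      · rwa [Finset.mem_singleton.1 hw]
    · rw [Finset.card_pair hne]
      exact hcard u _ fun v hv => (hmem u v).1 hv
  refine ⟨?_, ?_, ?_⟩
  · intro a b x y hab hbx hxy hax hby
    by_contra hne
    have hne : ¬ E.r (outerEmb a) (outerEmb b) := hne
    have h := sum_outer_crossing_eq_zero hr hs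
      (fun v => if E.r (outerEmb a) v then 1 else 0) (fun v => if E.r (outerEmb b) v then 1 else 0)
      (fun x y hxy => hind _ _ _ (hEr x y hxy)) (fun x y hxy => hind _ _ _ (hEs x y hxy))
      (fun x y hxy => hind _ _ _ (hEr x y hxy)) (fun x y hxy => hind _ _ _ (hEs x y hxy))
      fun v => by
        by_cases h : E.r (outerEmb a) v
        · exact .inr (if_neg fun h' => hne (E.trans' h (E.symm' h')))
        · exact .inl (if_neg h)
    simp only [hfil] at h
    have hax' : a ≠ x := by
      rintro rfl
      omega
    have hby' : b ≠ y := by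
      rintro rfl
      omega
    rw [hpair a x ((hmem _ _).2 hax) hax', hpair b y ((hmem _ _).2 hby) hby',
      Finset.sum_pair hax', Finset.sum_pair hby', Finset.sum_pair hby', if_pos hab,
      if_pos (by omega), if_neg (by omega), if_pos hxy] at h
    exact absurd h (by decide)
  · intro u
    obtain ⟨v, hv, hne⟩ : ∃ v ∈ F u, v ≠ u := by
      by_contra! hall
      have hFu : F u = {u} := Finset.eq_singleton_iff_unique_mem.2 ⟨hself u, hall⟩
      have h := hsum u
      rw [hFu, Finset.sum_singleton, colorSign] at h
      split_ifs at h
      omega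
    refine ⟨v, hne, (hmem u v).1 hv, fun w hw => ?_⟩
    have hw := (hmem u w).2 hw
    rw [hpair u v hv hne.symm] at hw
    simpa using hw
  · intro u v huv hne
    have h := hsum u
    rw [hpair u v ((hmem u v).2 huv) hne, Finset.sum_pair hne] at h
    exact (colorSign_add_eq_zero_iff _ _).1 h

end Gluing

theorem compRel_symm {q p : TCP} {h : q.l = p.k} {t t'} (ht : compRel q p h t t') :
    compRel q p h t' t := by
  rcases ht with ⟨x, y, hxy, rfl, rfl⟩ | ⟨x, y, hxy, rfl, rfl⟩
  · exact .inl ⟨y, x, q.rel.symm' hxy, rfl, rfl⟩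
  · exact .inr ⟨y, x, p.rel.symm' hxy, rfl, rfl⟩

theorem IsBicoloredPairing.comp {q p : TCP} (hq : IsBicoloredPairing q)
    (hp : IsBicoloredPairing p) (h : q.l = p.k) (hc : ColorsMatch q p h) :
    IsBicoloredPairing (comp q p h) := by
  rcases q with ⟨k, n, up, mid, r⟩
  rcases p with ⟨n', m, mid', low, s⟩
  dsimp only at h
  subst h
  obtain rfl : mid = mid' := funext fun j => hc j
  set q : TCP := ⟨k, n, up, mid, r⟩
  set p : TCP := ⟨n, m, mid, low, s⟩
  have hq : IsPairing (rowPos k n) (rowColor up mid) r := hq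
  have hp : IsPairing (rowPos n m) (rowColor mid low) s := hp
  have hemb : compEmbMid q p rfl = lowerEmb := by
    funext x
    rcases x with x | x <;> rfl
  set R : (Fin k ⊕ Fin n) ⊕ Fin m → (Fin k ⊕ Fin n) ⊕ Fin m → Prop := compRel q p rfl with hR
  refine isPairing_glue hq hp (Relation.EqvGen.setoid R)
    (fun x y hxy => .rel _ _ (.inl ⟨x, y, hxy, rfl, rfl⟩))
    (fun x y hxy => .rel _ _ (.inr ⟨x, y, hxy, by rw [hemb], by rw [hemb]⟩)) ?_
  intro u O hO
  choose f hfne hf hf' using hq.exists_partner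
  choose g hgne hg hg' using hp.exists_partner
  let G : SimpleGraph ((Fin k ⊕ Fin n) ⊕ Fin m) :=
    { Adj := fun v w => v ≠ w ∧ R v w
      symm := ⟨fun v w h => ⟨h.1.symm, compRel_symm h.2⟩⟩
      loopless := ⟨fun v h => h.1 rfl⟩ }
  let F : (Fin k ⊕ Fin n) ⊕ Fin m → (Fin k ⊕ Fin n) ⊕ Fin m :=
    Sum.elim (fun x => .inl (f x)) .inr
  let H : (Fin k ⊕ Fin n) ⊕ Fin m → (Fin k ⊕ Fin n) ⊕ Fin m :=
    Sum.elim (Sum.elim (fun i => .inl (.inl i)) fun j => lowerEmb (g (.inl j)))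
      fun j => lowerEmb (g (.inr j))
  have hH : ∀ x, H (lowerEmb x) = lowerEmb (g x) := by
    rintro (x | x) <;> rfl
  rw [← Finset.card_image_of_injective O (outerEmb_injective (n := n))]
  refine card_fixed_le_two G F H ?_ (outerEmb u) _ ?_
  · rintro v w ⟨hne, ⟨x, y, hxy, rfl, rfl⟩ | ⟨x, y, hxy, rfl, rfl⟩⟩
    · left
      exact congrArg _ ((hf' x y hxy).resolve_left fun h => hne (by rw [h]))
    · right
      rw [hemb, hH]
      exact congrArg _ ((hg' x y hxy).resolve_left fun h => hne (by rw [h]))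
  · intro v hv
    obtain ⟨v, hvO, rfl⟩ := Finset.mem_image.1 hv
    constructor
    · have hle : ∀ a b, Relation.EqvGen R a b → G.Reachable a b := by
        intro a b hab
        induction hab with
        | rel a b hab =>
          by_cases h : a = b
          · rw [h]
          · exact SimpleGraph.Adj.reachable (G := G) ⟨h, hab⟩
        | refl a => rfl
        | symm a b _ ih => exact ih.symm
        | trans a b c _ _ ih₁ ih₂ => exact ih₁.trans ih₂
      exact hle _ _ (hO v hvO)
    · rcases v with v | v
      · exact .inr rfl
      · exact .inl rfl

/-! ### Generating all bicolored pairings -/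

/-- The partition with `k` upper and `l` lower points whose upper (lower) points have colors `u`
(`d`) and block labels `a` (`b`). -/
def ofLabels (k l : ℕ) (u d : ℕ → Color) (a b : ℕ → ℕ) : TCP where
  k := k
  l := l
  upColor := fun i => u i.1
  lowColor := fun i => d i.1
  rel := Setoid.ker (Sum.elim (fun i => a i.1) (fun i => b i.1))

theorem ofLabels_congr {k l k' l' : ℕ} {u d u' d' : ℕ → Color} {a b a' b' : ℕ → ℕ}
    (hk : k = k') (hl : l = l') (hu : ∀ i < k, u i = u' i) (hd : ∀ i < l, d i = d' i)
    (huu : ∀ i < k, ∀ j < k, (a i = a j ↔ a' i = a' j))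
    (hud : ∀ i < k, ∀ j < l, (a i = b j ↔ a' i = b' j))
    (hdd : ∀ i < l, ∀ j < l, (b i = b j ↔ b' i = b' j)) :
    ofLabels k l u d a b = ofLabels k' l' u' d' a' b' :=
  TCP.eq_of hk hl (fun i h _ => hu i h) (fun i h _ => hd i h)
    (fun i j h _ g _ => huu i h j g) (fun i j h _ g _ => hud i h j g)
    (fun i j h _ g _ => hdd i h j g)

theorem tensor_ofLabels (k l k' l' : ℕ) (u d u' d' : ℕ → Color) (a b a' b' : ℕ → ℕ) :
    tensor (ofLabels k l u d a b) (ofLabels k' l' u' d' a' b') =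
      ofLabels (k + k') (l + l') (fun i => if i < k then u i else u' (i - k))
        (fun i => if i < l then d i else d' (i - l))
        (fun i => if i < k then 2 * a i else 2 * a' (i - k) + 1)
        (fun i => if i < l then 2 * b i else 2 * b' (i - l) + 1) := by
  have hup : ∀ x : Fin (k + k'), (finSumFinEquiv.symm x).elim (fun i : Fin k => u i.1)
      (fun i : Fin k' => u' i.1) = if x.1 < k then u x.1 else u' (x.1 - k) := fun x => by
    refine Fin.addCases (fun i => ?_) (fun i => ?_) x <;> simp
  have hlow : ∀ x : Fin (l + l'), (finSumFinEquiv.symm x).elim (fun i : Fin l => d i.1)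
      (fun i : Fin l' => d' i.1) = if x.1 < l then d x.1 else d' (x.1 - l) := fun x => by
    refine Fin.addCases (fun i => ?_) (fun i => ?_) x <;> simp
  set p := ofLabels k l u d a b with hp
  set q := ofLabels k' l' u' d' a' b' with hq
  let lab : (Fin k ⊕ Fin l) ⊕ (Fin k' ⊕ Fin l') → ℕ :=
    Sum.elim (Sum.elim (fun i => 2 * a i.1) (fun i => 2 * b i.1))
      (Sum.elim (fun i => 2 * a' i.1 + 1) (fun i => 2 * b' i.1 + 1))
  have hlab : ∀ x y, sumRel p.rel q.rel x y ↔ lab x = lab y := by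
    rintro ((x | x) | (x | x)) ((y | y) | (y | y))
    · change a x.1 = a y.1 ↔ 2 * a x.1 = 2 * a y.1
      omega
    · change a x.1 = b y.1 ↔ 2 * a x.1 = 2 * b y.1
      omega
    · change False ↔ 2 * a x.1 = 2 * a' y.1 + 1
      exact iff_of_false id (by omega)
    · change False ↔ 2 * a x.1 = 2 * b' y.1 + 1
      exact iff_of_false id (by omega)
    · change b x.1 = a y.1 ↔ 2 * b x.1 = 2 * a y.1
      omega
    · change b x.1 = b y.1 ↔ 2 * b x.1 = 2 * b y.1
      omega
    · change False ↔ 2 * b x.1 = 2 * a' y.1 + 1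
      exact iff_of_false id (by omega)
    · change False ↔ 2 * b x.1 = 2 * b' y.1 + 1
      exact iff_of_false id (by omega)
    · change False ↔ 2 * a' x.1 + 1 = 2 * a y.1
      exact iff_of_false id (by omega)
    · change False ↔ 2 * a' x.1 + 1 = 2 * b y.1
      exact iff_of_false id (by omega)
    · change a' x.1 = a' y.1 ↔ 2 * a' x.1 + 1 = 2 * a' y.1 + 1
      omega
    · change a' x.1 = b' y.1 ↔ 2 * a' x.1 + 1 = 2 * b' y.1 + 1
      omega
    · change False ↔ 2 * b' x.1 + 1 = 2 * a y.1
      exact iff_of_false id (by omega)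
    · change False ↔ 2 * b' x.1 + 1 = 2 * b y.1
      exact iff_of_false id (by omega)
    · change b' x.1 = a' y.1 ↔ 2 * b' x.1 + 1 = 2 * a' y.1 + 1
      omega
    · change b' x.1 = b' y.1 ↔ 2 * b' x.1 + 1 = 2 * b' y.1 + 1
      omega
  have hsplit : ∀ x : Fin (k + k') ⊕ Fin (l + l'), lab (splitPt p q x) =
      Sum.elim (fun i => if i.1 < k then 2 * a i.1 else 2 * a' (i.1 - k) + 1)
        (fun i => if i.1 < l then 2 * b i.1 else 2 * b' (i.1 - l) + 1) x := by
    rintro (x | x)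
    · change lab ((finSumFinEquiv.symm x).elim (fun a => .inl (.inl a)) fun b => .inr (.inl b)) = _
      refine Fin.addCases (fun i => ?_) (fun i => ?_) x <;> simp [lab]
    · change lab ((finSumFinEquiv.symm x).elim (fun a => .inl (.inr a)) fun b => .inr (.inr b)) = _
      refine Fin.addCases (fun i => ?_) (fun i => ?_) x <;> simp [lab]
  have hrel : ∀ x y : Fin (k + k') ⊕ Fin (l + l'), (tensor p q).rel.r x y ↔
      Sum.elim (fun i : Fin (k + k') => if i.1 < k then 2 * a i.1 else 2 * a' (i.1 - k) + 1)
        (fun i : Fin (l + l') => if i.1 < l then 2 * b i.1 else 2 * b' (i.1 - l) + 1) x =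
      Sum.elim (fun i => if i.1 < k then 2 * a i.1 else 2 * a' (i.1 - k) + 1)
        (fun i => if i.1 < l then 2 * b i.1 else 2 * b' (i.1 - l) + 1) y := fun x y => by
    rw [← hsplit, ← hsplit]
    exact hlab _ _
  exact TCP.eq_of rfl rfl (fun i h _ => hup ⟨i, h⟩) (fun i h _ => hlow ⟨i, h⟩)
    (fun i j h _ g _ => hrel (.inl ⟨i, h⟩) (.inl ⟨j, g⟩))
    (fun i j h _ g _ => hrel (.inl ⟨i, h⟩) (.inr ⟨j, g⟩))
    (fun i j h _ g _ => hrel (.inr ⟨i, h⟩) (.inr ⟨j, g⟩))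

theorem idPart_eq_ofLabels (c : Color) :
    idPart c = ofLabels 1 1 (fun _ => c) (fun _ => c) (fun _ => 0) fun _ => 0 :=
  TCP.eq_of rfl rfl (fun _ _ _ => rfl) (fun _ _ _ => rfl)
    (fun _ _ _ _ _ _ => iff_of_true trivial rfl) (fun _ _ _ _ _ _ => iff_of_true trivial rfl)
    (fun _ _ _ _ _ _ => iff_of_true trivial rfl)

theorem pairLower_eq_ofLabels (c₁ c₂ : Color) :
    pairLower c₁ c₂ = ofLabels 0 2 (fun _ => c₁) (fun i => if i = 0 then c₁ else c₂)
      (fun _ => 0) fun _ => 0 := by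
  refine TCP.eq_of rfl rfl (fun i h _ => absurd h (Nat.not_lt_zero i)) (fun i h _ => ?_)
    (fun i _ h => absurd h (Nat.not_lt_zero i)) (fun i _ h => absurd h (Nat.not_lt_zero i))
    (fun _ _ _ _ _ _ => iff_of_true rfl rfl)
  change i < 2 at h
  interval_cases i <;> rfl

/-- The increasing map on the natural numbers omitting `j` and `j + 1`. -/
def skipPair (j i : ℕ) : ℕ := if i < j then i else i + 2

/-- The identity partition with a pair inserted at the lower positions `j` and `j + 1`. -/
def cupLayer (n j : ℕ) (w : ℕ → Color) : TCP :=
  ofLabels n (n + 2) (fun i => w (skipPair j i)) w (skipPair j)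
    (fun i => if i = j + 1 then j else i)

section Generation

variable {C : Set TCP}

theorem IsCategory.pairLower_mem (hC : IsCategory C) (c : Color) : pairLower c (!c) ∈ C := by
  cases c
  · exact hC.pairbw_mem
  · exact hC.pairwb_mem

theorem IsCategory.idPart_mem (hC : IsCategory C) (c : Color) : idPart c ∈ C := by
  cases c
  · exact hC.idb_mem
  · exact hC.idw_mem

theorem IsCategory.mem_of_isEmpty (hC : IsCategory C) {p : TCP} (hk : p.k = 0) (hl : p.l = 0) :
    p ∈ C := by
  have h := hC.comp_mem _ (hC.pairLower_mem white) _ (hC.invol_mem _ (hC.pairLower_mem white)) rfl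
    fun _ => rfl
  convert h
  exact TCP.eq_of hk hl (fun i h => by omega) (fun i h => by omega) (fun i j h => by omega)
    (fun i j h => by omega) (fun i j h => by omega)

theorem IsCategory.idWord_mem (hC : IsCategory C) (n : ℕ) (w : ℕ → Color) :
    ofLabels n n w w id id ∈ C := by
  induction n with
  | zero => exact hC.mem_of_isEmpty rfl rfl
  | succ n ih =>
    have h := hC.tensor_mem _ ih _ (hC.idPart_mem (w n))
    rw [idPart_eq_ofLabels, tensor_ofLabels] at h
    convert h using 1
    have hcol : ∀ i < n + 1, w i = if i < n then w i else w n := fun i h => by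
      split_ifs
      · rfl
      · rw [show i = n by omega]
    have hlab : ∀ i < n + 1, ∀ j < n + 1, (id i = id j ↔
        (if i < n then 2 * id i else 2 * 0 + 1) = if j < n then 2 * id j else 2 * 0 + 1) := by
      intro i hi j hj
      simp only [id]
      split_ifs <;> omega
    exact ofLabels_congr rfl rfl hcol hcol hlab hlab hlab

theorem IsCategory.cupLayer_mem (hC : IsCategory C) {n j : ℕ} (hj : j ≤ n) (w : ℕ → Color)
    (hw : w (j + 1) = !(w j)) : cupLayer n j w ∈ C := by
  have h := hC.tensor_mem _ (hC.tensor_mem _ (hC.idWord_mem j w) _ (hC.pairLower_mem (w j))) _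
    (hC.idWord_mem (n - j) fun i => w (i + j + 2))
  rw [pairLower_eq_ofLabels, tensor_ofLabels, tensor_ofLabels] at h
  convert h using 1
  refine ofLabels_congr (by omega) (by omega) ?_ ?_ ?_ ?_ ?_
  · intro i hi
    simp only [skipPair, add_zero]
    split_ifs
    · rfl
    · congr 1
      omega
  · intro i hi
    split_ifs
    · rfl
    · congr 1
      omega
    · rw [← hw]
      congr 1
      omega
    · congr 1
      omega
  all_goals
    intro i hi i' hi'
    simp only [skipPair, id]
    split_ifs <;> omega

end Generation

/-! ### Removing adjacent pairs -/

theorem skipPair_lt {n j i : ℕ} (hi : i < n) : skipPair j i < n + 2 := by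
  unfold skipPair
  split_ifs <;> omega

theorem skipPair_inj {j i i' : ℕ} : skipPair j i = skipPair j i' ↔ i = i' := by
  unfold skipPair
  split_ifs <;> omega

theorem skipPair_ne (j i : ℕ) : skipPair j i ≠ j ∧ skipPair j i ≠ j + 1 := by
  unfold skipPair
  split_ifs <;> omega

theorem exists_skipPair_eq {n j m : ℕ} (hj : j ≤ n) (hm : m < n + 2) (h : m ≠ j)
    (h' : m ≠ j + 1) : ∃ i < n, skipPair j i = m := by
  unfold skipPair
  by_cases hmj : m < j
  · exact ⟨m, by omega, by simp [hmj]⟩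
  · exact ⟨m - 2, by omega, by rw [if_neg (by omega)]; omega⟩

/-- The inclusion of the points remaining after removal of the lower points `j` and `j + 1`. -/
def skipPoint (k n j : ℕ) : Fin k ⊕ Fin n → Fin k ⊕ Fin (n + 2) :=
  Sum.map id fun i => ⟨skipPair j i.1, skipPair_lt i.2⟩

theorem skipPoint_injective (k n j : ℕ) : Function.Injective (skipPoint k n j) :=
  Function.Injective.sumMap Function.injective_id fun _ _ h =>
    Fin.ext (skipPair_inj.1 (congrArg Fin.val h))

theorem exists_skipPoint_eq {k n j : ℕ} (hj : j ≤ n) (x : Fin k ⊕ Fin (n + 2))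
    (h : x ≠ .inr ⟨j, by omega⟩) (h' : x ≠ .inr ⟨j + 1, by omega⟩) :
    ∃ y, skipPoint k n j y = x := by
  rcases x with i | ⟨m, hm⟩
  · exact ⟨.inl i, rfl⟩
  · obtain ⟨i, hi, rfl⟩ := exists_skipPair_eq hj hm (fun e => h (by subst e; rfl))
      (fun e => h' (by subst e; rfl))
    exact ⟨.inr ⟨i, hi⟩, rfl⟩

/-- The partition obtained by removing the lower points `j` and `j + 1`. -/
def removePair {k n : ℕ} (j : ℕ) (u : Fin k → Color) (w : ℕ → Color)
    (r : Setoid (Fin k ⊕ Fin (n + 2))) : TCP where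
  k := k
  l := n
  upColor := u
  lowColor := fun i => w (skipPair j i.1)
  rel := Setoid.comap (skipPoint k n j) r

section RemovePair

variable {k n j : ℕ} {u : Fin k → Color} {w : ℕ → Color} {r : Setoid (Fin k ⊕ Fin (n + 2))}

theorem isBicoloredPairing_removePair (hj : j ≤ n)
    (hp : IsBicoloredPairing ⟨k, n + 2, u, fun i => w i.1, r⟩)
    (hr : r.r (.inr ⟨j, by omega⟩) (.inr ⟨j + 1, by omega⟩)) :
    IsBicoloredPairing (removePair j u w r) := by
  refine IsPairing.of_embedding hp (X := Fin k ⊕ Fin n) (skipPoint k n j)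
    (skipPoint_injective k n j) ?_ ?_ (fun _ _ => Iff.rfl) ?_
  · rintro (x | x) (y | y) h
    · exact h
    · change k - 1 - x.1 < k + skipPair j y.1
      omega
    · change k + x.1 < k - 1 - y.1 at h
      omega
    · change k + x.1 < k + y.1 at h
      change k + skipPair j x.1 < k + skipPair j y.1
      unfold skipPair
      split_ifs <;> omega
  · rintro (x | x) <;> rfl
  · intro x z hxz
    have hne : (.inr ⟨j + 1, by omega⟩ : Fin k ⊕ Fin (n + 2)) ≠ .inr ⟨j, by omega⟩ := by simp
    have hx : ∀ (h : j < n + 2), skipPoint k n j x ≠ .inr ⟨j, h⟩ := fun h => by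
      rcases x with x | x
      · exact Sum.inl_ne_inr
      · exact fun e => (skipPair_ne j x.1).1 (congrArg Fin.val (Sum.inr_injective e))
    have hx' : ∀ (h : j + 1 < n + 2), skipPoint k n j x ≠ .inr ⟨j + 1, h⟩ := fun h => by
      rcases x with x | x
      · exact Sum.inl_ne_inr
      · exact fun e => (skipPair_ne j x.1).2 (congrArg Fin.val (Sum.inr_injective e))
    refine exists_skipPoint_eq hj z ?_ ?_
    · rintro rfl
      exact hx' _ (IsPairing.eq_of_rel hp hr hne (r.symm' hxz) (hx _))
    · rintro rfl
      exact hx _ (IsPairing.eq_of_rel hp (r.symm' hr) hne.symm (r.symm' hxz) (hx' _))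

theorem comp_removePair_cupLayer (hj : j ≤ n)
    (hp : IsBicoloredPairing ⟨k, n + 2, u, fun i => w i.1, r⟩)
    (hr : r.r (.inr ⟨j, by omega⟩) (.inr ⟨j + 1, by omega⟩)) :
    comp (removePair j u w r) (cupLayer n j w) rfl = ⟨k, n + 2, u, fun i => w i.1, r⟩ := by
  set q := removePair j u w r with hq
  set T := (Fin k ⊕ Fin n) ⊕ Fin (n + 2)
  let R : T → T → Prop := compRel q (cupLayer n j w) rfl
  let φ : T → Fin k ⊕ Fin (n + 2) := Sum.elim (skipPoint k n j) .inr
  let e : Fin k ⊕ Fin (n + 2) → T := Sum.elim (fun i => .inl (.inl i)) .inr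
  have hφe : ∀ x, φ (e x) = x := by
    rintro (x | x) <;> rfl
  have hcup : ∀ x y : Fin n ⊕ Fin (n + 2), (cupLayer n j w).rel.r x y ↔
      Sum.elim (fun i => skipPair j i.1) (fun i => if i.1 = j + 1 then j else i.1) x =
      Sum.elim (fun i => skipPair j i.1) (fun i => if i.1 = j + 1 then j else i.1) y :=
    fun x y => Iff.rfl
  have hlab : ∀ x : Fin n ⊕ Fin (n + 2), ∀ m (hm : m < n + 2),
      Sum.elim (fun i => skipPair j i.1) (fun i => if i.1 = j + 1 then j else i.1) x = m →
      r.r (φ (compEmbMid q (cupLayer n j w) rfl x)) (.inr ⟨m, hm⟩) := by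
    rintro (x | x) m hm h
    · change skipPair j x.1 = m at h
      subst h
      exact r.refl' _
    · change (if x.1 = j + 1 then j else x.1) = m at h
      split_ifs at h with hx
      · obtain ⟨x, hxn⟩ := x
        change x = j + 1 at hx
        subst hx h
        exact r.symm' hr
      · subst h
        exact r.refl' _
  have hφ : ∀ s t, R s t → r.r (φ s) (φ t) := by
    rintro s t (⟨x, y, hxy, rfl, rfl⟩ | ⟨x, y, hxy, rfl, rfl⟩)
    · exact hxy
    · have hxy := (hcup x y).1 hxy
      have hlt : Sum.elim (fun i => skipPair j i.1) (fun i => if i.1 = j + 1 then j else i.1)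
          (y : Fin n ⊕ Fin (n + 2)) < n + 2 := by
        rcases y with y | y
        · exact skipPair_lt y.2
        · change (if y.1 = j + 1 then j else y.1) < n + 2
          split_ifs
          · omega
          · exact y.2
      exact r.trans' (hlab x _ hlt hxy) (r.symm' (hlab y _ hlt rfl))
  have hφ' : ∀ s t, Relation.EqvGen R s t → r.r (φ s) (φ t) := by
    intro s t h
    induction h with
    | rel _ _ h => exact hφ _ _ h
    | refl => exact r.refl' _
    | symm _ _ _ ih => exact r.symm' ih
    | trans _ _ _ _ _ ih ih' => exact r.trans' ih ih'
  have hlift : ∀ y, Relation.EqvGen R (.inl y) (e (skipPoint k n j y)) := by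
    rintro (y | y)
    · exact .refl _
    · refine .rel _ _ (.inr ⟨.inl y, .inr ⟨skipPair j y.1, skipPair_lt y.2⟩, (hcup _ _).2 ?_,
        rfl, rfl⟩)
      change skipPair j y.1 = if skipPair j y.1 = j + 1 then j else skipPair j y.1
      rw [if_neg (skipPair_ne j y.1).2]
  have hpair : Relation.EqvGen R (e (.inr ⟨j, by omega⟩)) (e (.inr ⟨j + 1, by omega⟩)) := by
    have hlabel : (if j = j + 1 then j else j) = if j + 1 = j + 1 then j else j + 1 := by simp
    have h : (cupLayer n j w).rel.r (.inr (⟨j, by omega⟩ : Fin (n + 2)))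
        (.inr (⟨j + 1, by omega⟩ : Fin (n + 2))) := (hcup _ _).2 hlabel
    exact .rel _ _ (.inr ⟨_, _, h, rfl, rfl⟩)
  have hne : (.inr ⟨j + 1, by omega⟩ : Fin k ⊕ Fin (n + 2)) ≠ .inr ⟨j, by omega⟩ := by simp
  have key : ∀ x y, Relation.EqvGen R (e x) (e y) ↔ r.r x y := by
    refine fun x y => ⟨fun h => by simpa only [hφe] using hφ' _ _ h, fun h => ?_⟩
    by_cases hxy : x = y
    · exact hxy ▸ .refl _
    by_cases hx : x = .inr ⟨j, by omega⟩
    · subst hx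
      rw [IsPairing.eq_of_rel hp hr hne h (Ne.symm hxy)]
      exact hpair
    by_cases hx' : x = .inr ⟨j + 1, by omega⟩
    · subst hx'
      rw [IsPairing.eq_of_rel hp (r.symm' hr) hne.symm h (Ne.symm hxy)]
      exact hpair.symm
    obtain ⟨x', rfl⟩ := exists_skipPoint_eq hj x hx hx'
    obtain ⟨y', rfl⟩ := exists_skipPoint_eq hj y
      (fun hy => hx' (IsPairing.eq_of_rel hp hr hne (hy ▸ r.symm' h) (hy ▸ hxy)))
      (fun hy => hx (IsPairing.eq_of_rel hp (r.symm' hr) hne.symm (hy ▸ r.symm' h) (hy ▸ hxy)))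
    exact ((hlift x').symm).trans _ _ _ (.trans _ _ _ (.rel _ _ (.inl ⟨x', y', h, rfl, rfl⟩))
      (hlift y'))
  exact TCP.eq_of rfl rfl (fun _ _ _ => rfl) (fun _ _ _ => rfl)
    (fun i i' h _ g _ => key (.inl ⟨i, h⟩) (.inl ⟨i', g⟩))
    (fun i i' h _ g _ => key (.inl ⟨i, h⟩) (.inr ⟨i', g⟩))
    (fun i i' h _ g _ => key (.inr ⟨i, h⟩) (.inr ⟨i', g⟩))

end RemovePair

variable {C : Set TCP}

theorem exists_smaller_of_lower (hC : IsCategory C) {p : TCP} (hp : IsBicoloredPairing p) {j : ℕ}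
    (hj : j + 1 < p.l) (hr : p.rel.r (.inr ⟨j, by omega⟩) (.inr ⟨j + 1, hj⟩)) :
    ∃ p', IsBicoloredPairing p' ∧ p'.k + p'.l < p.k + p.l ∧ (p' ∈ C → p ∈ C) := by
  obtain ⟨k, l, u, d, r⟩ := p
  change j + 1 < l at hj
  obtain ⟨n, rfl⟩ : ∃ n, l = n + 2 := ⟨l - 2, by omega⟩
  obtain ⟨w, rfl⟩ : ∃ w : ℕ → Color, d = fun i => w i.1 :=
    ⟨fun i => if h : i < n + 2 then d ⟨i, h⟩ else true, funext fun i => by simp⟩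
  have hjn : j ≤ n := by omega
  have hw : w (j + 1) = !(w j) :=
    hp.color_eq (.inr ⟨j + 1, hj⟩) (.inr ⟨j, (Nat.lt_succ_self j).trans hj⟩) (r.symm' hr)
      (by simp)
  refine ⟨removePair j u w r, isBicoloredPairing_removePair hjn hp hr, ?_, fun h => ?_⟩
  · change k + n < k + (n + 2)
    omega
  · rw [← comp_removePair_cupLayer hjn hp hr]
    exact hC.comp_mem _ h _ (hC.cupLayer_mem hjn w hw) rfl fun _ => rfl

theorem exists_smaller_of_upper (hC : IsCategory C) {p : TCP} (hp : IsBicoloredPairing p) {j : ℕ}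
    (hj : j + 1 < p.k) (hr : p.rel.r (.inl ⟨j, by omega⟩) (.inl ⟨j + 1, hj⟩)) :
    ∃ p', IsBicoloredPairing p' ∧ p'.k + p'.l < p.k + p.l ∧ (p' ∈ C → p ∈ C) := by
  obtain ⟨p', hp', hlt, hmem⟩ := exists_smaller_of_lower hC hp.invol (j := j) hj hr
  refine ⟨p', hp', hlt.trans_eq (Nat.add_comm p.l p.k), fun h => ?_⟩
  have hinv : invol (invol p) = p := TCP.eq_of rfl rfl (fun _ _ _ => rfl) (fun _ _ _ => rfl)
    (fun _ _ _ _ _ _ => Iff.rfl) (fun _ _ _ _ _ _ => Iff.rfl) (fun _ _ _ _ _ _ => Iff.rfl)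
  rw [← hinv]
  exact hC.invol_mem _ (hmem h)

theorem exists_smaller_of_through (hC : IsCategory C) {p : TCP} (hp : IsBicoloredPairing p)
    (hk : 0 < p.k) (hl : 0 < p.l) (hr : p.rel.r (.inl ⟨0, hk⟩) (.inr ⟨0, hl⟩)) :
    ∃ p', IsBicoloredPairing p' ∧ p'.k + p'.l < p.k + p.l ∧ (p' ∈ C → p ∈ C) := by
  obtain ⟨k, l, u, d, r⟩ := p
  change 0 < k at hk
  change 0 < l at hl
  obtain ⟨m, rfl⟩ : ∃ m, k = m + 1 := ⟨k - 1, by omega⟩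
  obtain ⟨n, rfl⟩ : ∃ n, l = n + 1 := ⟨l - 1, by omega⟩
  have hcol : u 0 = d 0 := by
    have h := hp.color_eq (.inl 0) (.inr 0) hr Sum.inl_ne_inr
    exact Bool.not_inj h
  have hinl : ∀ z, r.r (.inl 0) z → z ≠ .inl 0 → z = .inr 0 := fun z h =>
    IsPairing.eq_of_rel hp hr Sum.inr_ne_inl h
  have hinr : ∀ z, r.r (.inr 0) z → z ≠ .inr 0 → z = .inl 0 := fun z h =>
    IsPairing.eq_of_rel hp (r.symm' hr) Sum.inl_ne_inr h
  let e : Fin m ⊕ Fin n → Fin (m + 1) ⊕ Fin (n + 1) := Sum.map Fin.succ Fin.succ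
  have hel : ∀ x, e x ≠ .inl 0 := by
    rintro (x | x) <;> simp [e]
  have her : ∀ x, e x ≠ .inr 0 := by
    rintro (x | x) <;> simp [e]
  have hsurj : ∀ z, z ≠ .inl 0 → z ≠ .inr 0 → ∃ x, e x = z := by
    rintro (z | z) h h'
    · exact ⟨.inl (z.pred fun hz => h (hz ▸ rfl)), by simp [e]⟩
    · exact ⟨.inr (z.pred fun hz => h' (hz ▸ rfl)), by simp [e]⟩
  let p' : TCP := ⟨m, n, fun i => u i.succ, fun i => d i.succ, Setoid.comap e r⟩
  refine ⟨p', ?_, ?_, fun h => ?_⟩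
  · refine IsPairing.of_embedding hp (X := Fin m ⊕ Fin n) e
      (Function.Injective.sumMap (Fin.succ_injective m) (Fin.succ_injective n)) ?_ ?_
      (fun _ _ => Iff.rfl) fun x z hxz => hsurj z ?_ ?_
    · rintro (x | x) (y | y) h
      · change m - 1 - x.1 < m - 1 - y.1 at h
        change m + 1 - 1 - (x.1 + 1) < m + 1 - 1 - (y.1 + 1)
        omega
      · change m + 1 - 1 - (x.1 + 1) < m + 1 + (y.1 + 1)
        omega
      · change m + x.1 < m - 1 - y.1 at h
        omega
      · change m + x.1 < m + y.1 at h
        change m + 1 + (x.1 + 1) < m + 1 + (y.1 + 1)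
        omega
    · rintro (x | x) <;> rfl
    · rintro rfl
      exact her x (hinl _ (r.symm' hxz) (hel x))
    · rintro rfl
      exact hel x (hinr _ (r.symm' hxz) (her x))
  · change m + n < m + 1 + (n + 1)
    omega
  · have hmem := hC.tensor_mem _ (hC.idPart_mem (u 0)) _ h
    let g : (Fin 1 ⊕ Fin 1) ⊕ (Fin m ⊕ Fin n) → Fin (m + 1) ⊕ Fin (n + 1) :=
      Sum.elim (Sum.map (fun _ => 0) fun _ => 0) e
    have hg : ∀ s t, sumRel (idPart (u 0)).rel p'.rel s t ↔ r.r (g s) (g t) := by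
      have hcross : ∀ (s : Fin 1 ⊕ Fin 1) (t : Fin m ⊕ Fin n), ¬ r.r (g (.inl s)) (g (.inr t)) := by
        rintro (s | s) t hst
        · exact her t (hinl _ hst (hel t))
        · exact hel t (hinr _ hst (her t))
      rintro (s | s) (t | t)
      · refine iff_of_true trivial ?_
        rcases s with s | s <;> rcases t with t | t
        · exact r.refl' _
        · exact hr
        · exact r.symm' hr
        · exact r.refl' _
      · exact iff_of_false id (hcross s t)
      · exact iff_of_false id fun hst => hcross t s (r.symm' hst)
      · exact Iff.rfl
    have hsplit : ∀ x : Fin (1 + m) ⊕ Fin (1 + n), g (splitPt (idPart (u 0)) p' x) =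
        Sum.map (Fin.cast (Nat.add_comm 1 m)) (Fin.cast (Nat.add_comm 1 n)) x := by
      rintro (x | x)
      · change g ((finSumFinEquiv.symm x).elim (fun a => .inl (.inl a)) fun b => .inr (.inl b)) = _
        refine Fin.addCases (fun i => ?_) (fun i => ?_) x <;> simp [g, e, Fin.ext_iff]
      · change g ((finSumFinEquiv.symm x).elim (fun a => .inl (.inr a)) fun b => .inr (.inr b)) = _
        refine Fin.addCases (fun i => ?_) (fun i => ?_) x <;> simp [g, e, Fin.ext_iff]
    have hrel : ∀ x y : Fin (1 + m) ⊕ Fin (1 + n), (tensor (idPart (u 0)) p').rel.r x y ↔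
        r.r (Sum.map (Fin.cast (Nat.add_comm 1 m)) (Fin.cast (Nat.add_comm 1 n)) x)
          (Sum.map (Fin.cast (Nat.add_comm 1 m)) (Fin.cast (Nat.add_comm 1 n)) y) := fun x y => by
      rw [← hsplit, ← hsplit]
      exact hg _ _
    have hup : ∀ x : Fin (1 + m), (finSumFinEquiv.symm x).elim (fun _ => u 0)
        (fun i : Fin m => u i.succ) = u (Fin.cast (Nat.add_comm 1 m) x) := fun x => by
      refine Fin.addCases (fun i => ?_) (fun i => ?_) x
      · simp
        congr 1
        simp [Fin.ext_iff]
      · simp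
    have hlow : ∀ x : Fin (1 + n), (finSumFinEquiv.symm x).elim (fun _ => u 0)
        (fun i : Fin n => d i.succ) = d (Fin.cast (Nat.add_comm 1 n) x) := fun x => by
      rw [hcol]
      refine Fin.addCases (fun i => ?_) (fun i => ?_) x
      · simp
        congr 1
        simp [Fin.ext_iff]
      · simp
    convert hmem using 1
    symm
    exact TCP.eq_of (Nat.add_comm 1 m) (Nat.add_comm 1 n) (fun i h _ => hup ⟨i, h⟩)
      (fun i h _ => hlow ⟨i, h⟩) (fun i j h _ g _ => hrel (.inl ⟨i, h⟩) (.inl ⟨j, g⟩))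
      (fun i j h _ g _ => hrel (.inl ⟨i, h⟩) (.inr ⟨j, g⟩))
      (fun i j h _ g _ => hrel (.inr ⟨i, h⟩) (.inr ⟨j, g⟩))

theorem exists_adjacent {p : TCP} (hp : IsBicoloredPairing p) (h : 0 < p.k + p.l) :
    ∃ x y, p.rel.r x y ∧ linePos p y = linePos p x + 1 := by
  classical
  let P : ℕ → Prop := fun n => ∃ x y, p.rel.r x y ∧ linePos p y = linePos p x + 1 + n
  have hP : ∃ n, P n := by
    obtain ⟨y, hne, hxy, -⟩ := hp.exists_partner (linePoint p ⟨0, h⟩)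
    have hx := linePos_linePoint p ⟨0, h⟩
    have hy : linePos p y ≠ linePos p (linePoint p ⟨0, h⟩) := fun h => hne (linePos_injective p h)
    refine ⟨linePos p y - 1, _, y, hxy, ?_⟩
    rw [hx] at hy ⊢
    change linePos p y ≠ 0 at hy
    change linePos p y = 0 + 1 + (linePos p y - 1)
    omega
  obtain ⟨x, y, hxy, hpos⟩ := Nat.find_spec hP
  rcases Nat.eq_zero_or_pos (Nat.find hP) with h0 | h0
  · exact ⟨x, y, hxy, by rw [hpos, h0]⟩
  exfalso
  have hlt := linePos_lt p y
  set z := linePoint p ⟨linePos p x + 1, by omega⟩ with hz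
  have hzpos : linePos p z = linePos p x + 1 := linePos_linePoint p _
  obtain ⟨t, hne, hzt, -⟩ := hp.exists_partner z
  have htz : linePos p t ≠ linePos p z := fun h => hne (linePos_injective p h)
  have hzx : ¬ p.rel.r x z := fun hxz => by
    have hzy : z = y := IsPairing.eq_of_rel hp hxy (fun h => by rw [h] at hpos; omega) hxz
      (fun h => by rw [h] at hzpos; omega)
    rw [hzy] at hzpos
    omega
  have htx : linePos p t ≠ linePos p x := fun h =>
    hzx (linePos_injective p h ▸ p.rel.symm' hzt)
  have hty : linePos p t ≠ linePos p y := fun h =>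
    hzx (p.rel.trans' hxy (linePos_injective p h ▸ p.rel.symm' hzt))
  rcases lt_trichotomy (linePos p t) (linePos p y) with hlt | heq | hgt
  · rcases Nat.lt_or_ge (linePos p t) (linePos p x) with h₁ | h₁
    · exact hzx (p.rel.trans' (p.rel.symm' (hp.noncrossing t x z y h₁ (by omega) (by omega)
        (p.rel.symm' hzt) hxy)) (p.rel.symm' hzt))
    · exact Nat.find_min hP (m := linePos p t - linePos p z - 1) (by omega)
        ⟨z, t, hzt, by omega⟩
  · exact hty heq
  · exact hzx (hp.noncrossing x z y t (by omega) (by omega) hgt hxy hzt)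

theorem exists_smaller (hC : IsCategory C) {p : TCP} (hp : IsBicoloredPairing p)
    (h : 0 < p.k + p.l) :
    ∃ p', IsBicoloredPairing p' ∧ p'.k + p'.l < p.k + p.l ∧ (p' ∈ C → p ∈ C) := by
  obtain ⟨x | x, y | y, hxy, hpos⟩ := exists_adjacent hp h
  · simp only [linePos_inl] at hpos
    obtain ⟨x, hx⟩ := x
    obtain ⟨y, hy⟩ := y
    obtain rfl : x = y + 1 := by
      change p.k - 1 - y = p.k - 1 - x + 1 at hpos
      omega
    exact exists_smaller_of_upper hC hp hx (p.rel.symm' hxy)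
  · simp only [linePos_inl, linePos_inr] at hpos
    obtain ⟨x, hx⟩ := x
    obtain ⟨y, hy⟩ := y
    change p.k + y = p.k - 1 - x + 1 at hpos
    obtain rfl : x = 0 := by omega
    obtain rfl : y = 0 := by omega
    exact exists_smaller_of_through hC hp hx hy hxy
  · simp only [linePos_inl, linePos_inr] at hpos
    omega
  · simp only [linePos_inr] at hpos
    obtain ⟨x, hx⟩ := x
    obtain ⟨y, hy⟩ := y
    obtain rfl : y = x + 1 := by
      change p.k + y = p.k + x + 1 at hpos
      omega
    exact exists_smaller_of_lower hC hp hy hxy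

theorem IsBicoloredPairing.mem (hC : IsCategory C) {p : TCP} (hp : IsBicoloredPairing p) :
    p ∈ C := by
  induction hn : p.k + p.l using Nat.strong_induction_on generalizing p with
  | _ n ih =>
    rcases Nat.eq_zero_or_pos n with h0 | h0
    · exact hC.mem_of_isEmpty (by omega) (by omega)
    · obtain ⟨p', hp', hlt, hmem⟩ := exists_smaller hC hp (by omega)
      exact hmem (ih _ (by omega) hp' rfl)

theorem isCategory_setOf_isBicoloredPairing : IsCategory {p | IsBicoloredPairing p} where
  tensor_mem _ hp _ hq := IsBicoloredPairing.tensor hp hq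
  comp_mem _ hq _ hp h hc := IsBicoloredPairing.comp hq hp h hc
  invol_mem _ hp := IsBicoloredPairing.invol hp
  idw_mem := isBicoloredPairing_idPart white
  idb_mem := isBicoloredPairing_idPart black
  pairwb_mem := isBicoloredPairing_pairLower white
  pairbw_mem := isBicoloredPairing_pairLower black

/-- `⟨∅⟩` consists of the noncrossing pair partitions all of whose blocks connect a white
and a black point, when rotated to a partition with no upper points. -/
theorem stmt_10 :
    generated ∅ =
      {p : TCP | Noncrossing p ∧ (∀ x : Fin p.k ⊕ Fin p.l, blockSize p x = 2) ∧
        ∀ j j' : Fin (toLine p).l, (toLine p).rel.r (Sum.inr j) (Sum.inr j') → j ≠ j' →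
          (toLine p).lowColor j = !((toLine p).lowColor j')} := by
  ext p
  rw [Set.mem_ofPred_eq, ← isBicoloredPairing_iff]
  exact ⟨fun h => h _ isCategory_setOf_isBicoloredPairing (Set.empty_subset _),
    fun h C hC _ => h.mem hC⟩

end CTCP
end
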